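/- Let A be a commutative noetherian ring of finite Krull dimension. For every cochain complex P of projective A-modules there exist a totally acyclic cochain complex T of projective A-modules and a chain map t : T → P such that, for every totally acyclic cochain complex S of projective A-modules, composition with t induces a bijection from the set of homotopy classes of chain maps S → T to the set of homotopy classes of chain maps S → P. -/

import Mathlib

universe u

/-- A cochain complex `(X, d)` of projective `A`-modules is *totally acyclic* if it is acyclic
and `Hom_A(X, Q)` is acyclic for every projective `A`-module `Q`. -/
def IsTotallyAcyclic (A : Type u) [CommRing A] (X : ℤ → Type u)
    [∀ n, AddCommGroup (X n)] [∀ n, Module A (X n)]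
    (d : ∀ n, X n →ₗ[A] X (n + 1)) : Prop :=
  (∀ n, Function.Exact (d n) (d (n + 1))) ∧
  ∀ (Q : Type u) [AddCommGroup Q] [Module A Q], Module.Projective A Q →
    ∀ n, Function.Exact (LinearMap.lcomp A Q (d (n + 1))) (LinearMap.lcomp A Q (d n))

/-- A chain map between two cochain complexes of `A`-modules. -/
def IsChainMap (A : Type u) [CommRing A]
    (X : ℤ → Type u) [∀ n, AddCommGroup (X n)] [∀ n, Module A (X n)]
    (dX : ∀ n, X n →ₗ[A] X (n + 1))
    (Y : ℤ → Type u) [∀ n, AddCommGroup (Y n)] [∀ n, Module A (Y n)]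
    (dY : ∀ n, Y n →ₗ[A] Y (n + 1))
    (f : ∀ n, X n →ₗ[A] Y n) : Prop :=
  ∀ n (x : X n), f (n + 1) (dX n x) = dY n (f n x)

/-- Two chain maps are chain homotopic. -/
def ChainHomotopic (A : Type u) [CommRing A]
    (X : ℤ → Type u) [∀ n, AddCommGroup (X n)] [∀ n, Module A (X n)]
    (dX : ∀ n, X n →ₗ[A] X (n + 1))
    (Y : ℤ → Type u) [∀ n, AddCommGroup (Y n)] [∀ n, Module A (Y n)]
    (dY : ∀ n, Y n →ₗ[A] Y (n + 1))
    (f g : ∀ n, X n →ₗ[A] Y n) : Prop :=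
  ∃ s : ∀ n, X (n + 1) →ₗ[A] Y n,
    ∀ n (x : X (n + 1)),
      f (n + 1) x - g (n + 1) x = dY n (s n x) + s (n + 1) (dX (n + 1) x)

section
open TensorProduct

theorem tac_exists_inj (A : Type u) [CommRing A] (N : Type u) [AddCommGroup N] [Module A N] :
    ∃ (E : Type u) (_ : AddCommGroup E) (_ : Module A E) (j : N →ₗ[A] E),
      Module.Injective A E ∧ Function.Injective j := by
  have : Module.Injective A (CharacterModule A) :=
    Module.Flat.iff_characterModule_injective.mp inferInstance
  let tw : CharacterModule N → (N →ₗ[A] CharacterModule A) := fun c =>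
    { toFun := fun m => (c : N →+ AddCircle (1:ℚ)).comp
        ((LinearMap.toSpanSingleton A N m).toAddMonoidHom)
      map_add' := by
        intro x y
        refine CharacterModule.ext A fun a => ?_
        exact (congrArg c (smul_add a x y)).trans (map_add c _ _)
      map_smul' := by
        intro r x
        refine CharacterModule.ext A fun a => ?_
        change c (a • r • x) = c ((r • a) • x)
        rw [smul_smul, smul_eq_mul, mul_comm] }
  refine ⟨CharacterModule N → CharacterModule A, inferInstance, inferInstance,
    LinearMap.pi tw, inferInstance, ?_⟩
  rw [injective_iff_map_eq_zero]
  intro n hn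
  refine CharacterModule.eq_zero_of_character_apply fun c => ?_
  have h1 := DFunLike.congr_fun (congrFun hn c) (1 : A)
  have h2 : c ((1 : A) • n) = 0 := h1
  simpa using h2

theorem tac_hull (A : Type u) [CommRing A] (N : Type u) [AddCommGroup N] [Module A N] :
    ∃ (E : Type u) (_ : AddCommGroup E) (_ : Module A E) (j : N →ₗ[A] E),
      Module.Injective A E ∧ Function.Injective j ∧
      ∀ x : E, x ≠ 0 → ∃ a : A, a • x ≠ 0 ∧ a • x ∈ LinearMap.range j := by
  obtain ⟨E, _, _, j, hE, hj⟩ := tac_exists_inj A N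
  set R := LinearMap.range j with hR
  -- maximal essential extension
  obtain ⟨L, hRL, hL⟩ := zorn_le_nonempty₀
    {L : Submodule A E | ∀ x ∈ L, x ≠ 0 → ∃ a : A, a • x ≠ 0 ∧ a • x ∈ R} (by
      intro c hc hch y hy
      refine ⟨sSup c, ?_, fun z hz => le_sSup hz⟩
      intro x hx hx0
      rw [Submodule.mem_sSup_of_directed ⟨y, hy⟩ hch.directedOn] at hx
      obtain ⟨L, hL, hxL⟩ := hx
      exact hc hL x hxL hx0) R (by
      intro x hx hx0
      exact ⟨1, by simpa using hx0, by simpa using hx⟩)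
  obtain ⟨K, -, hK⟩ := zorn_le_nonempty₀
    {K : Submodule A E | ∀ x ∈ K, x ∈ L → x = 0} (by
      intro c hc hch y hy
      refine ⟨sSup c, ?_, fun z hz => le_sSup hz⟩
      intro x hx hx0
      rw [Submodule.mem_sSup_of_directed ⟨y, hy⟩ hch.directedOn] at hx
      obtain ⟨L, hL, hxL⟩ := hx
      exact hc hL x hxL hx0) ⊥ (by
      intro x hx _
      simpa using hx)
  have key : ∀ e : E, e ∉ K → ∃ k ∈ K, ∃ a : A, k + a • e ∈ L ∧ k + a • e ≠ 0 := by
    intro e he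
    by_contra hcon
    push Not at hcon
    apply he
    have : K ⊔ Submodule.span A {e} ≤ K := by
      apply hK.2 _ le_sup_left
      intro x hx hxL
      obtain ⟨k, hk, y, hy, rfl⟩ := Submodule.mem_sup.mp hx
      obtain ⟨a, rfl⟩ := Submodule.mem_span_singleton.mp hy
      exact hcon k hk a hxL
    exact this (Submodule.mem_sup_right (Submodule.mem_span_singleton_self e))
  have hqinj : Function.Injective (K.mkQ ∘ₗ L.subtype) := by
    rw [injective_iff_map_eq_zero]
    rintro ⟨x, hx⟩ h
    have : x ∈ K := by simpa using h
    exact Subtype.ext (hK.1 x this hx)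
  obtain ⟨θ, hθ⟩ := Module.Injective.extension_property A E _ _ (K.mkQ ∘ₗ L.subtype) hqinj L.subtype
  have hθ' : ∀ x ∈ L, θ (K.mkQ x) = x := fun x hx => DFunLike.congr_fun hθ ⟨x, hx⟩
  have hrange : ∀ e : E, θ (K.mkQ e) ∈ L := by
    have : LinearMap.range θ ≤ L := by
      apply hL.2
      · rintro _ ⟨x, rfl⟩ hx
        obtain ⟨e, rfl⟩ := K.mkQ_surjective x
        have heK : e ∉ K := by
          intro h
          apply hx
          rw [(Submodule.Quotient.mk_eq_zero K).mpr h |> fun h => (show K.mkQ e = 0 from h), map_zero]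
        obtain ⟨k, hk, a, h1, h2⟩ := key e heK
        have h3 := hθ' _ h1
        have h4 : K.mkQ k = 0 := by simpa using hk
        rw [map_add, h4, zero_add, map_smul, map_smul] at h3
        obtain ⟨b, hb, hb'⟩ := hL.1 _ h1 h2
        rw [← h3] at hb hb'
        exact ⟨b * a, by rwa [mul_smul], by rwa [mul_smul]⟩
      · intro x hx
        exact ⟨_, hθ' x hx⟩
    exact fun e => this ⟨_, rfl⟩
  let r : E →ₗ[A] L := LinearMap.codRestrict L (θ ∘ₗ K.mkQ) hrange
  have hr : ∀ x : L, r x = x := fun x => Subtype.ext (hθ' x.1 x.2)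
  refine ⟨L, inferInstance, inferInstance, LinearMap.codRestrict L j (fun n => hRL ⟨n, rfl⟩), ?_, ?_, ?_⟩
  · constructor
    intro X Y _ _ _ _ i hi f
    obtain ⟨h, hh⟩ := Module.Injective.out i hi (L.subtype ∘ₗ f)
    refine ⟨r ∘ₗ h, fun x => ?_⟩
    rw [LinearMap.comp_apply, hh x]
    exact hr _
  · intro x y h
    exact hj (congrArg Subtype.val h)
  · rintro ⟨x, hx⟩ hx0
    obtain ⟨a, h1, n, hn⟩ := hL.1 x hx (by simpa using hx0)
    exact ⟨a, by simpa [Subtype.ext_iff] using h1, n, Subtype.ext hn⟩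

theorem tac_exists_Ep (A : Type u) [CommRing A] (p : Ideal A) [p.IsPrime] :
    ∃ (E : Type u) (_ : AddCommGroup E) (_ : Module A E) (x0 : E),
      Module.Injective A E ∧ (∀ a : A, a • x0 = 0 ↔ a ∈ p) ∧
      (∀ s : A, s ∉ p → ∀ y : E, s • y = 0 → y = 0) ∧
      (∀ y : E, (∀ a ∈ p, a • y = 0) → ∃ s : A, s ∉ p ∧ ∃ a : A, s • y = a • x0) := by
  obtain ⟨E, _, _, j, hE, hj, hess⟩ := tac_hull A (A ⧸ p)
  have hx0 : ∀ a : A, a • j 1 = 0 ↔ a ∈ p := by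
    intro a
    rw [← map_smul, map_eq_zero_iff j hj, ← Ideal.Quotient.eq_zero_iff_mem]
    rw [Algebra.smul_def, mul_one]; rfl
  have hr : ∀ x ∈ LinearMap.range j, ∃ a : A, x = a • j 1 := by
    rintro _ ⟨y, rfl⟩
    obtain ⟨a, rfl⟩ := Ideal.Quotient.mk_surjective y
    refine ⟨a, ?_⟩
    rw [← map_smul, Algebra.smul_def, mul_one]; rfl
  refine ⟨E, inferInstance, inferInstance, j 1, hE, hx0, ?_, ?_⟩
  · intro s hs y hy
    by_contra hy0
    obtain ⟨a, ha, ha'⟩ := hess y hy0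
    obtain ⟨b, hb⟩ := hr _ ha'
    have h1 : (s * b) • j 1 = 0 := by rw [mul_smul, ← hb, smul_comm, hy, smul_zero]
    rw [hx0] at h1
    rcases Ideal.IsPrime.mem_or_mem ‹_› h1 with h | h
    · exact hs h
    · rw [← hx0, ← hb] at h
      exact ha h
  · intro y hy
    by_cases hy0 : y = 0
    · exact ⟨1, (Ideal.ne_top_iff_one p).mp (Ideal.IsPrime.ne_top ‹_›), 0, by simp [hy0]⟩
    · obtain ⟨a, ha, ha'⟩ := hess y hy0
      obtain ⟨b, hb⟩ := hr _ ha'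
      exact ⟨a, fun h => ha (hy a h), b, hb⟩


theorem tac_inj_factor {A : Type u} [CommRing A] {N X Y : Type u} [AddCommGroup N] [Module A N]
    [AddCommGroup X] [Module A X] [AddCommGroup Y] [Module A Y] (hN : Module.Injective A N)
    (α : X →ₗ[A] Y) (h : X →ₗ[A] N) (hh : ∀ x, α x = 0 → h x = 0) :
    ∃ y : Y →ₗ[A] N, ∀ x, y (α x) = h x := by
  have hle : LinearMap.ker α ≤ LinearMap.ker h := fun x hx => hh x hx
  let h' := (LinearMap.ker α).liftQ h hle
  let α' := (LinearMap.ker α).liftQ α le_rfl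
  have hα' : Function.Injective α' := by
    rw [← LinearMap.ker_eq_bot]
    exact Submodule.ker_liftQ_eq_bot _ _ _ le_rfl
  obtain ⟨y, hy⟩ := Module.Injective.extension_property A N _ _ α' hα' h'
  refine ⟨y, fun x => ?_⟩
  have := DFunLike.congr_fun hy ((LinearMap.ker α).mkQ x)
  simpa [α', h'] using this

theorem tac_comp_inj {A : Type u} [CommRing A] (F E M : Type u) [AddCommGroup F] [Module A F]
    [AddCommGroup E] [Module A E] [AddCommGroup M] [Module A M] [Module.Flat A F]
    [Module.Finite A M] :
    Function.Injective (TensorProduct.lTensorHomToHomLTensor (.id A) M F E) := by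
  obtain ⟨n, π, hπ⟩ := Module.Finite.exists_fin' A M
  have h1 : Function.Injective (LinearMap.lTensor F (LinearMap.lcomp A E π)) := by
    apply Module.Flat.lTensor_preserves_injective_linearMap
    exact LinearMap.lcomp_injective_of_surjective _ hπ
  have h2 : Function.Injective (TensorProduct.lTensorHomToHomLTensor (.id A) (Fin n → A) F E) := by
    rw [← lTensorHomEquivHomLTensor_toLinearMap]
    exact (lTensorHomEquivHomLTensor A _ F E).injective
  have h3 : (LinearMap.lcomp A (F ⊗[A] E) π) ∘ₗ
      (TensorProduct.lTensorHomToHomLTensor (.id A) M F E) =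
      (TensorProduct.lTensorHomToHomLTensor (.id A) (Fin n → A) F E) ∘ₗ
        (LinearMap.lTensor F (LinearMap.lcomp A E π)) := by
    apply TensorProduct.ext'
    intro x y
    ext i
    simp [LinearMap.lcomp_apply]
  have h4 : Function.Injective ((LinearMap.lcomp A (F ⊗[A] E) π) ∘ₗ
      (TensorProduct.lTensorHomToHomLTensor (.id A) M F E)) := by
    rw [h3]
    exact h2.comp h1
  exact Function.Injective.of_comp (f := LinearMap.lcomp A (F ⊗[A] E) π) (by simpa using h4)

theorem tac_comp_surj {A : Type u} [CommRing A] [IsNoetherianRing A]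
    (F E M : Type u) [AddCommGroup F] [Module A F]
    [AddCommGroup E] [Module A E] [AddCommGroup M] [Module A M] [Module.Flat A F]
    [Module.Finite A M] :
    Function.Surjective (TensorProduct.lTensorHomToHomLTensor (.id A) M F E) := by
  intro φ
  obtain ⟨n, π, hπ⟩ := Module.Finite.exists_fin' A M
  let ι := (LinearMap.ker π).subtype
  have hex : Function.Exact (LinearMap.lcomp A E π) (LinearMap.lcomp A E ι) :=
    LinearMap.exact_lcomp_of_exact_of_surjective _ (LinearMap.exact_subtype_ker_map π) hπ
  have hex' := Module.Flat.lTensor_exact F hex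
  have hnat : ∀ {X Y : Type u} [AddCommGroup X] [Module A X] [AddCommGroup Y] [Module A Y]
      (j : X →ₗ[A] Y) (u : F ⊗[A] (Y →ₗ[A] E)),
      TensorProduct.lTensorHomToHomLTensor (.id A) X F E (LinearMap.lTensor F (LinearMap.lcomp A E j) u)
        = TensorProduct.lTensorHomToHomLTensor (.id A) Y F E u ∘ₗ j := by
    intro X Y _ _ _ _ j u
    induction u with
    | zero => simp
    | add x y hx hy => simp [hx, hy, LinearMap.add_comp]
    | tmul x y => ext i; simp [LinearMap.lcomp_apply]
  obtain ⟨u, hu⟩ := (lTensorHomEquivHomLTensor A (Fin n → A) F E).surjective (φ ∘ₗ π)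
  rw [lTensorHomEquivHomLTensor_apply] at hu
  have h0 : LinearMap.lTensor F (LinearMap.lcomp A E ι) u = 0 := by
    apply tac_comp_inj F E (LinearMap.ker π)
    rw [hnat, hu, map_zero]
    ext x
    have : π x.1 = 0 := x.2
    simp [ι, this]
  obtain ⟨v, rfl⟩ := (hex' u).mp h0
  refine ⟨v, ?_⟩
  rw [hnat] at hu
  ext x
  obtain ⟨y, rfl⟩ := hπ x
  exact DFunLike.congr_fun hu y

theorem tac_tensor_injective {A : Type u} [CommRing A] [IsNoetherianRing A]
    (F E : Type u) [AddCommGroup F] [Module A F]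
    [AddCommGroup E] [Module A E] [Module.Flat A F] (hE : Module.Injective A E) :
    Module.Injective A (F ⊗[A] E) := by
  apply Module.Baer.injective
  intro I g
  obtain ⟨v, hv⟩ := tac_comp_surj F E I g
  have hs : Function.Surjective (LinearMap.lcomp A E (I.subtype : I →ₗ[A] A)) := by
    intro f
    obtain ⟨k, hk⟩ := Module.Injective.extension_property A E _ _ (I.subtype : I →ₗ[A] A)
      Subtype.val_injective f
    exact ⟨k, hk⟩
  obtain ⟨w, rfl⟩ := LinearMap.lTensor_surjective F hs v
  refine ⟨TensorProduct.lTensorHomToHomLTensor (.id A) A F E w, fun x hx => ?_⟩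
  rw [← hv]
  clear hv
  induction w with
  | zero => simp
  | add a b ha hb => simp only [map_add, LinearMap.add_apply, ha, hb]
  | tmul a b => simp [LinearMap.lcomp_apply]

theorem tac_H_flat {A : Type u} [CommRing A] [IsNoetherianRing A] {κ : Type u}
    (I N : κ → Type u) [∀ k, AddCommGroup (I k)] [∀ k, Module A (I k)]
    [∀ k, AddCommGroup (N k)] [∀ k, Module A (N k)]
    (hI : ∀ k, Module.Injective A (I k)) (hN : ∀ k, Module.Injective A (N k)) :
    Module.Flat A (∀ k, I k →ₗ[A] N k) := by
  apply Module.Flat.of_forall_isTrivialRelation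
  intro l a h hrel
  -- syzygies
  let σ : (Fin l → A) →ₗ[A] A := Fintype.linearCombination A a
  obtain ⟨m, b, hb⟩ := Submodule.fg_iff_exists_fin_generating_family.mp
    (IsNoetherian.noetherian (LinearMap.ker σ))
  have hbσ : ∀ j, ∑ i, b j i * a i = 0 := by
    intro j
    have : b j ∈ LinearMap.ker σ := by
      rw [← hb]; exact Submodule.subset_span ⟨j, rfl⟩
    simpa [σ, Fintype.linearCombination_apply] using this
  have key : ∀ k, ∃ y : (Fin m → I k) →ₗ[A] N k, ∀ x : Fin l → I k,
      y (fun j => ∑ i, b j i • x i) = ∑ i, h i k (x i) := by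
    intro k
    let α : (Fin l → I k) →ₗ[A] (Fin m → I k) :=
      LinearMap.pi fun j => ∑ i, b j i • LinearMap.proj i
    let hk : (Fin l → I k) →ₗ[A] N k := ∑ i, h i k ∘ₗ LinearMap.proj i
    obtain ⟨y, hy⟩ := tac_inj_factor (hN k) α hk (by
      intro x hx
      have hx' : ∀ j, ∑ i, b j i • x i = 0 := by
        intro j
        simpa [α] using congrFun hx j
      -- x i = a i • e
      obtain ⟨e, he⟩ : ∃ e : I k, ∀ i, x i = a i • e := by
        obtain ⟨ψ, hψ⟩ := tac_inj_factor (hI k) σ (Fintype.linearCombination A x) (by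
          intro c hc
          have hc' : c ∈ Submodule.span A (Set.range b) := by rw [hb]; exact hc
          have : Submodule.span A (Set.range b) ≤
              LinearMap.ker (Fintype.linearCombination A x) := by
            rw [Submodule.span_le]
            rintro _ ⟨j, rfl⟩
            simpa [Fintype.linearCombination_apply] using hx' j
          exact this hc')
        refine ⟨ψ 1, fun i => ?_⟩
        have := hψ (Pi.single i 1)
        simp only [σ, Fintype.linearCombination_apply_single, one_smul] at this
        rw [← this, ← map_smul, smul_eq_mul, mul_one]
      have : (∑ i, a i • h i) k e = 0 := by rw [hrel]; simp
      simp only [hk, LinearMap.sum_apply, LinearMap.comp_apply, LinearMap.proj_apply, he, map_smul]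
      simpa [Finset.sum_apply, LinearMap.sum_apply] using this)
    refine ⟨y, fun x => ?_⟩
    have := hy x
    have h3 : α x = fun j => ∑ i, b j i • x i := by
      funext j
      simp [α, LinearMap.sum_apply]
    rw [← h3, this]
    simp [hk, LinearMap.sum_apply]
  choose y hy using key
  refine ⟨m, fun i j => b j i, fun j k => y k ∘ₗ LinearMap.single A (fun _ => I k) j, ?_, ?_⟩
  · intro i
    funext k
    ext x
    have := hy k (Pi.single i x)
    have h1 : ∑ i', h i' k ((Pi.single i x : Fin l → I k) i') = h i k x := by
      rw [Finset.sum_eq_single i]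
      · simp
      · intro i' _ hne; simp [Pi.single_eq_of_ne hne]
      · simp
    rw [h1] at this
    rw [← this]
    have h2 : (fun j => ∑ i', b j i' • (Pi.single i x : Fin l → I k) i') =
        ∑ j, b j i • (Pi.single j x : Fin m → I k) := by
      funext j
      rw [Finset.sum_eq_single i]
      · simp [Finset.sum_apply, Pi.single_apply]
      · intro i' _ hne; simp [Pi.single_eq_of_ne hne]
      · simp
    rw [h2, map_sum]
    simp [Finset.sum_apply, LinearMap.sum_apply]
  · intro j
    rw [← hbσ j]
    exact Finset.sum_congr rfl fun i _ => mul_comm _ _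

theorem tac_H_quot {A : Type u} [CommRing A] [IsNoetherianRing A] {κ : Type u}
    (I N : κ → Type u) [∀ k, AddCommGroup (I k)] [∀ k, Module A (I k)]
    [∀ k, AddCommGroup (N k)] [∀ k, Module A (N k)]
    (hN : ∀ k, Module.Injective A (N k)) (q : Ideal A)
    (h : ∀ k, I k →ₗ[A] N k) (hh : ∀ k (x : I k), (∀ a ∈ q, a • x = 0) → h k x = 0) :
    h ∈ q • (⊤ : Submodule A (∀ k, I k →ₗ[A] N k)) := by
  obtain ⟨m, b, hb⟩ := Submodule.fg_iff_exists_fin_generating_family.mp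
    (IsNoetherian.noetherian q)
  have key : ∀ k, ∃ y : (Fin m → I k) →ₗ[A] N k, ∀ x : I k,
      y (fun j => b j • x) = h k x := by
    intro k
    let α : I k →ₗ[A] (Fin m → I k) := LinearMap.pi fun j => b j • LinearMap.id
    obtain ⟨y, hy⟩ := tac_inj_factor (hN k) α (h k) (by
      intro x hx
      apply hh
      intro a ha
      rw [← hb] at ha
      have : Submodule.span A (Set.range b) ≤ LinearMap.ker (LinearMap.toSpanSingleton A _ x) := by
        rw [Submodule.span_le]
        rintro _ ⟨j, rfl⟩
        simpa [α] using congrFun hx j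
      simpa using this ha)
    exact ⟨y, fun x => hy x⟩
  choose y hy using key
  have : h = ∑ j, b j • (fun k => y k ∘ₗ LinearMap.single A (fun _ => I k) j :
      ∀ k, I k →ₗ[A] N k) := by
    funext k
    ext x
    rw [← hy k x]
    have h2 : (fun j => b j • x) = ∑ j, b j • (Pi.single j x : Fin m → I k) := by
      funext j
      simp [Finset.sum_apply, Pi.single_apply]
    rw [h2, map_sum]
    simp [Finset.sum_apply, LinearMap.sum_apply]
  rw [this]
  refine Submodule.sum_mem _ fun j _ => Submodule.smul_mem_smul ?_ trivial
  rw [← hb]; exact Submodule.subset_span ⟨j, rfl⟩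


structure TacData (A : Type u) [CommRing A] where
  E : PrimeSpectrum A → Type u
  acg : ∀ p, AddCommGroup (E p)
  mod : ∀ p, Module A (E p)
  x0 : ∀ p, E p
  inj : ∀ p, Module.Injective A (E p)
  ann : ∀ p (a : A), a • x0 p = 0 ↔ a ∈ p.asIdeal
  reg : ∀ p (s : A), s ∉ p.asIdeal → ∀ y : E p, s • y = 0 → y = 0
  soc : ∀ p (y : E p), (∀ a ∈ p.asIdeal, a • y = 0) →
    ∃ s : A, s ∉ p.asIdeal ∧ ∃ a : A, s • y = a • x0 p

attribute [instance] TacData.acg TacData.mod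

theorem tac_data_nonempty (A : Type u) [CommRing A] : Nonempty (TacData A) := by
  have h := fun p : PrimeSpectrum A => tac_exists_Ep A p.asIdeal
  choose E acg mod x0 h1 h2 h3 h4 using h
  exact ⟨⟨E, acg, mod, x0, h1, h2, h3, h4⟩⟩

theorem tac_detect {A : Type u} [CommRing A] [IsNoetherianRing A] (D : TacData A)
    (h : PrimeSpectrum A → ℕ) (i : ℕ) (F : Type u) [AddCommGroup F] [Module A F] [Module.Flat A F]
    (hF : ∀ q : PrimeSpectrum A, h q < i → ∀ f : F, f ∈ q.asIdeal • (⊤ : Submodule A F))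
    (M : Type u) [AddCommGroup M] [Module A M] [hM : Module.Finite A M] :
    ∀ z : F ⊗[A] M, z ≠ 0 → ∃ p : PrimeSpectrum A, i ≤ h p ∧
      ∃ g : M →ₗ[A] D.E p, LinearMap.lTensor F g z ≠ 0 := by
  induction hM using IsNoetherianRing.induction_on_isQuotientEquivQuotientPrime A with
  | subsingleton N =>
    intro z hz
    exact absurd (Subsingleton.elim z 0) hz
  | quotient N p e =>
    intro z hz
    by_cases hp : h p < i
    · exfalso
      apply hz
      clear hz
      induction z with
      | zero => rfl
      | add x y hx hy => rw [hx, hy, add_zero]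
      | tmul f n =>
        have := hF p hp f
        induction this using Submodule.smul_induction_on' with
        | smul a ha f _ =>
          rw [TensorProduct.smul_tmul]
          have : a • n = 0 := by
            apply e.injective
            rw [map_smul, map_zero]
            obtain ⟨b, hb⟩ := Ideal.Quotient.mk_surjective (e n)
            rw [← hb, Algebra.smul_def]
            change Ideal.Quotient.mk _ a * _ = 0
            rw [Ideal.Quotient.eq_zero_iff_mem.mpr ha, zero_mul]
          rw [this, tmul_zero]
        | add x _ y _ hx hy => rw [TensorProduct.add_tmul, hx, hy, add_zero]
    · refine ⟨p, not_lt.mp hp, ?_⟩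
      let g0 : (A ⧸ p.asIdeal) →ₗ[A] D.E p :=
        Submodule.liftQ p.asIdeal (LinearMap.toSpanSingleton A _ (D.x0 p)) (by
          intro a ha
          simpa using (D.ann p a).mpr ha)
      have hg0 : Function.Injective g0 := by
        rw [← LinearMap.ker_eq_bot]
        apply Submodule.ker_liftQ_eq_bot
        intro a ha
        exact (D.ann p a).mp (by simpa using ha)
      refine ⟨g0 ∘ₗ e.toLinearMap, fun h0 => hz ?_⟩
      have : Function.Injective (LinearMap.lTensor F (g0 ∘ₗ e.toLinearMap)) :=
        Module.Flat.lTensor_preserves_injective_linearMap _ (hg0.comp e.injective)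
      exact this (by rw [h0, map_zero])
  | exact N₁ N₂ N₃ f g hf hg hfg h₁ h₃ =>
    intro z hz
    by_cases hz3 : LinearMap.lTensor F g z = 0
    · obtain ⟨z1, rfl⟩ := (lTensor_exact F hfg hg z).mp hz3
      obtain ⟨p, hp, k, hk⟩ := h₁ z1 (by rintro rfl; exact hz (map_zero _))
      have := D.inj p
      obtain ⟨k', hk'⟩ := Module.Injective.extension_property A _ _ _ f hf k
      refine ⟨p, hp, k', ?_⟩
      rwa [← LinearMap.comp_apply, ← LinearMap.lTensor_comp, hk']
    · obtain ⟨p, hp, k, hk⟩ := h₃ _ hz3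
      refine ⟨p, hp, k ∘ₗ g, ?_⟩
      rwa [LinearMap.lTensor_comp]

theorem tac_smul_top {A : Type u} [CommRing A] [IsNoetherianRing A]
    (F : Type u) [AddCommGroup F] [Module A F] (I : Ideal A)
    (hI : ∀ q : PrimeSpectrum A, I ≤ q.asIdeal → q.asIdeal • (⊤ : Submodule A F) = ⊤) :
    I • (⊤ : Submodule A F) = ⊤ := by
  induction I using IsNoetherian.induction with
  | hgt I ih =>
    change Ideal A at I
    by_cases hp : I.IsPrime
    · exact hI ⟨I, hp⟩ le_rfl
    by_cases ht : I = ⊤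
    · subst ht; simp
    obtain ⟨x, hx, y, hy, hxy⟩ := (Ideal.not_isPrime_iff.mp hp).resolve_left ht
    have h1 := ih (I ⊔ Ideal.span {x}) (left_lt_sup.mpr (by simpa using hx))
      (fun q hq => hI q (le_sup_left.trans hq))
    have h2 := ih (I ⊔ Ideal.span {y}) (left_lt_sup.mpr (by simpa using hy))
      (fun q hq => hI q (le_sup_left.trans hq))
    have h3 : (I ⊔ Ideal.span {x}) * (I ⊔ Ideal.span {y}) ≤ I := by
      rw [Ideal.sup_mul, Ideal.mul_sup, Ideal.mul_sup, Ideal.span_singleton_mul_span_singleton]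
      refine sup_le (sup_le Ideal.mul_le_left Ideal.mul_le_left) (sup_le Ideal.mul_le_right ?_)
      rw [Ideal.span_le]; simpa using hxy
    rw [eq_top_iff]
    calc (⊤ : Submodule A F) = (I ⊔ Ideal.span {x}) • ((I ⊔ Ideal.span {y}) • ⊤) := by
          rw [h2, h1]
      _ = ((I ⊔ Ideal.span {x}) * (I ⊔ Ideal.span {y})) • ⊤ := by
          rw [← smul_assoc, smul_eq_mul]
      _ ≤ I • ⊤ := Submodule.smul_mono_left h3


theorem tac_soc {A : Type u} [CommRing A] [IsNoetherianRing A] (D : TacData A)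
    (F : Type u) [AddCommGroup F] [Module A F] [Module.Flat A F] (q : PrimeSpectrum A)
    (hF : ∀ p : PrimeSpectrum A, q < p → p.asIdeal • (⊤ : Submodule A F) = ⊤)
    (w : F ⊗[A] D.E q) (hw : ∀ a ∈ q.asIdeal, a • w = 0) : ∃ f : F, w = f ⊗ₜ D.x0 q := by
  let φ : (A ⧸ q.asIdeal) →ₗ[A] (F ⊗[A] D.E q) :=
    Submodule.liftQ q.asIdeal (LinearMap.toSpanSingleton A _ w) (by
      intro a ha
      simpa using hw a ha)
  obtain ⟨v, hv⟩ := tac_comp_surj F (D.E q) (A ⧸ q.asIdeal) φ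
  have h1 : w = φ (Submodule.mkQ q.asIdeal 1) := by
    change w = (1 : A) • w
    rw [one_smul]
  rw [h1, ← hv]
  clear hv h1 φ
  induction v with
  | zero => exact ⟨0, by simp⟩
  | add x y hx hy =>
    obtain ⟨f, hf⟩ := hx
    obtain ⟨g, hg⟩ := hy
    exact ⟨f + g, by rw [map_add, LinearMap.add_apply, hf, hg, add_tmul]⟩
  | tmul f l =>
    rw [lTensorHomToHomLTensor_apply]
    set y := l (Submodule.mkQ q.asIdeal 1) with hy
    obtain ⟨s, hs, a, hsa⟩ := D.soc q y (by
      intro a ha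
      rw [hy, ← map_smul, ← map_smul, smul_eq_mul, mul_one]
      have : Submodule.mkQ q.asIdeal a = 0 := by simpa using Ideal.Quotient.eq_zero_iff_mem.mpr ha
      rw [this, map_zero])
    have hy0 : ∀ a ∈ q.asIdeal, a • y = 0 := by
      intro a ha
      rw [hy, ← map_smul, ← map_smul, smul_eq_mul, mul_one]
      have : Submodule.mkQ q.asIdeal a = 0 := by simpa using Ideal.Quotient.eq_zero_iff_mem.mpr ha
      rw [this, map_zero]
    have hf : f ∈ (q.asIdeal ⊔ Ideal.span {s}) • (⊤ : Submodule A F) := by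
      rw [tac_smul_top F]
      · trivial
      · intro p hp
        apply hF
        refine lt_of_le_of_ne (le_sup_left.trans hp) ?_
        rintro rfl
        exact hs (hp (Ideal.mem_sup_right (Ideal.mem_span_singleton_self s)))
    induction hf using Submodule.smul_induction_on' with
    | smul b hb f _ =>
      obtain ⟨b1, hb1, b2, hb2, rfl⟩ := Submodule.mem_sup.mp hb
      obtain ⟨c, rfl⟩ := Ideal.mem_span_singleton'.mp hb2
      refine ⟨(c * a) • f, ?_⟩
      rw [smul_tmul, smul_tmul, add_smul, hy0 b1 hb1, zero_add, mul_smul, hsa, mul_smul]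
    | add x _ y _ hx hy =>
      obtain ⟨f, hf⟩ := hx
      obtain ⟨g, hg⟩ := hy
      exact ⟨f + g, by rw [add_tmul, hf, hg, add_tmul]⟩

theorem tac_step {A : Type u} [CommRing A] [IsNoetherianRing A] (D : TacData A)
    (h : PrimeSpectrum A → ℕ) (hh : ∀ p q, p < q → h q < h p)
    (i : ℕ) (F : Type u) [AddCommGroup F] [Module A F] [Module.Flat A F]
    (hF : ∀ q : PrimeSpectrum A, h q < i → ∀ f : F, f ∈ q.asIdeal • (⊤ : Submodule A F)) :
    ∃ (κ : Type u) (pr : κ → PrimeSpectrum A) (N : κ → Type u) (_ : ∀ k, AddCommGroup (N k))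
      (_ : ∀ k, Module A (N k)) (_ : ∀ k, Module.Injective A (N k))
      (C : Type u) (_ : AddCommGroup C) (_ : Module A C)
      (j : F →ₗ[A] (∀ k, D.E (pr k) →ₗ[A] N k)) (c : (∀ k, D.E (pr k) →ₗ[A] N k) →ₗ[A] C),
      Function.Injective j ∧ Function.Surjective c ∧ Function.Exact j c ∧ Module.Flat A C ∧
      ∀ q : PrimeSpectrum A, h q < i + 1 → ∀ f : C, f ∈ q.asIdeal • (⊤ : Submodule A C) := by
  let κ : Type u := {p : PrimeSpectrum A // i ≤ h p}
  let T := ∀ k : κ, D.E k.1 →ₗ[A] (F ⊗[A] D.E k.1)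
  let η : F →ₗ[A] T := LinearMap.pi fun k => TensorProduct.mk A F (D.E k.1)
  have hNinj : ∀ k : κ, Module.Injective A (F ⊗[A] D.E k.1) :=
    fun k => tac_tensor_injective F _ (D.inj _)
  have hT : Module.Flat A T := tac_H_flat _ _ (fun k => D.inj k.1) hNinj
  have hη : ∀ (M : Type u) [AddCommGroup M] [Module A M] [Module.Finite A M],
      Function.Injective (LinearMap.rTensor M η) := by
    intro M _ _ _
    rw [injective_iff_map_eq_zero]
    intro z hz
    by_contra hz0
    obtain ⟨p, hp, g, hg⟩ := tac_detect D h i F hF M z hz0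
    let ev : T ⊗[A] M →ₗ[A] (F ⊗[A] D.E p) :=
      TensorProduct.lift ((LinearMap.lcomp A _ g) ∘ₗ
        (LinearMap.proj (φ := fun k : κ => D.E k.1 →ₗ[A] (F ⊗[A] D.E k.1)) (⟨p, hp⟩ : κ)))
    have : ev ∘ₗ LinearMap.rTensor M η = LinearMap.lTensor F g := by
      apply TensorProduct.ext'
      intro x y
      simp only [ev, η, LinearMap.comp_apply, LinearMap.rTensor_tmul, TensorProduct.lift.tmul]
      rfl
    apply hg
    rw [← this, LinearMap.comp_apply, hz, map_zero]
  refine ⟨κ, fun k => k.1, fun k => F ⊗[A] D.E k.1, inferInstance, inferInstance, hNinj,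
    T ⧸ LinearMap.range η, inferInstance, inferInstance, η, (LinearMap.range η).mkQ, ?_,
    Submodule.mkQ_surjective _, LinearMap.exact_map_mkQ_range η, ?_, ?_⟩
  · have := hη A
    intro x y hxy
    have h2 : x ⊗ₜ[A] (1 : A) = y ⊗ₜ[A] (1 : A) := by
      apply this
      simp [LinearMap.rTensor_tmul, hxy]
    have := congrArg (TensorProduct.rid A F) h2
    simpa using this
  · rw [Module.Flat.iff_lTensor_injective']
    intro I
    exact lTensor_injective_of_exact_of_exact_of_rTensor_injective
      (LinearMap.exact_map_mkQ_range η) (Submodule.mkQ_surjective _)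
      (LinearMap.exact_subtype_mkQ I) (Submodule.mkQ_surjective _) (hη _)
      (Module.Flat.lTensor_preserves_injective_linearMap _ Subtype.val_injective)
  · intro q hq c
    obtain ⟨τ, rfl⟩ := Submodule.mkQ_surjective _ c
    suffices hs : ∃ f : F, τ - η f ∈ q.asIdeal • (⊤ : Submodule A T) by
      obtain ⟨f, hf⟩ := hs
      have h1 : (LinearMap.range η).mkQ τ = (LinearMap.range η).mkQ (τ - η f) := by
        rw [map_sub]
        have : (LinearMap.range η).mkQ (η f) = 0 := by simp
        rw [this, sub_zero]
      rw [h1]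
      have := Submodule.mem_map_of_mem (f := (LinearMap.range η).mkQ) hf
      rw [Submodule.map_smul''] at this
      exact Submodule.smul_mono le_rfl le_top this
    have hle : ∀ (k : κ) (x : D.E k.1), (∀ a ∈ q.asIdeal, a • x = 0) → x ≠ 0 → k.1 = q := by
      intro k x hx hx0
      have h1 : q ≤ k.1 := by
        intro a ha
        by_contra hak
        exact hx0 (D.reg _ a hak x (hx a ha))
      by_contra hne
      have := hh _ _ (lt_of_le_of_ne h1 (Ne.symm hne))
      have := k.2
      omega
    by_cases hqi : i ≤ h q
    · obtain ⟨f, hf⟩ := tac_soc D F q (by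
        intro p hp
        have := hh _ _ hp
        rw [eq_top_iff]
        intro f _
        exact hF p (by omega) f) (τ ⟨q, hqi⟩ (D.x0 q)) (by
        intro a ha
        rw [← map_smul, (D.ann q a).mpr ha, map_zero])
      refine ⟨f, tac_H_quot _ _ hNinj _ _ ?_⟩
      rintro k x hx
      by_cases hx0 : x = 0
      · rw [hx0, map_zero]
      obtain ⟨k, hk⟩ := k
      have : k = q := hle _ x hx hx0
      subst this
      obtain ⟨s, hs, a, hsa⟩ := D.soc k x hx
      have hsinj : Function.Injective (LinearMap.lTensor F (s • (LinearMap.id : D.E k →ₗ[A] D.E k))) := by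
        apply Module.Flat.lTensor_preserves_injective_linearMap
        rw [injective_iff_map_eq_zero]
        intro y hy
        exact D.reg k s hs y (by simpa using hy)
      apply hsinj
      rw [LinearMap.lTensor_smul, LinearMap.smul_apply, LinearMap.lTensor_id, LinearMap.id_apply,
        map_zero, ← map_smul, hsa, map_smul]
      have : (τ - η f) ⟨k, hk⟩ (D.x0 k) = 0 := by
        change τ ⟨k, hk⟩ (D.x0 k) - f ⊗ₜ D.x0 k = 0
        rw [hf, sub_self]
      rw [this, smul_zero]
    · refine ⟨0, tac_H_quot _ _ hNinj _ _ ?_⟩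
      rintro k x hx
      by_cases hx0 : x = 0
      · rw [hx0, map_zero]
      have := hle _ x hx hx0
      have h3 := k.2
      rw [this] at h3
      omega

theorem tac_dev {A : Type u} [CommRing A] [IsNoetherianRing A] (D : TacData A)
    (h : PrimeSpectrum A → ℕ) (hh : ∀ p q, p < q → h q < h p) (d : ℕ) (hd : ∀ p, h p ≤ d)
    (Φ : ℕ → ∀ (F : Type u) [AddCommGroup F] [Module A F], Prop)
    (h0 : ∀ (F : Type u) [AddCommGroup F] [Module A F] [Subsingleton F], Φ 0 F)
    (hs : ∀ (n : ℕ) (F : Type u) [AddCommGroup F] [Module A F] [Module.Flat A F]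
      (κ : Type u) (pr : κ → PrimeSpectrum A) (N : κ → Type u) [∀ k, AddCommGroup (N k)]
      [∀ k, Module A (N k)] (_ : ∀ k, Module.Injective A (N k))
      (C : Type u) [AddCommGroup C] [Module A C] [Module.Flat A C]
      (j : F →ₗ[A] (∀ k, D.E (pr k) →ₗ[A] N k)) (c : (∀ k, D.E (pr k) →ₗ[A] N k) →ₗ[A] C),
      Function.Injective j → Function.Surjective c → Function.Exact j c → Φ n C → Φ (n + 1) F)
    (F : Type u) [AddCommGroup F] [Module A F] [Module.Flat A F] : Φ (d + 1) F := by
  have key : ∀ n i, n + i = d + 1 → ∀ (F : Type u) [AddCommGroup F] [Module A F] [Module.Flat A F],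
      (∀ q : PrimeSpectrum A, h q < i → ∀ f : F, f ∈ q.asIdeal • (⊤ : Submodule A F)) → Φ n F := by
    intro n
    induction n with
    | zero =>
      intro i hi F _ _ _ hF
      have : Subsingleton F := by
        refine subsingleton_of_forall_eq 0 fun f => ?_
        by_contra hf
        obtain ⟨p, hp, _⟩ := tac_detect D h i F hF A (f ⊗ₜ 1) (by
          intro h0
          have := congrArg (TensorProduct.rid A F) h0
          simp at this
          exact hf this)
        have := hd p
        omega
      exact h0 F
    | succ n ih =>
      intro i hi F _ _ _ hF
      obtain ⟨κ, pr, N, _, _, hN, C, _, _, j, c, h1, h2, h3, h4, h5⟩ := tac_step D h hh i F hF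
      exact hs n F κ pr N hN C j c h1 h2 h3 (ih (i + 1) (by omega) C h5)
  exact key (d + 1) 0 rfl F (fun q hq => absurd hq (by omega))

theorem tac_height {A : Type u} [CommRing A] (hdim : ringKrullDim A < ⊤) :
    ∃ (h : PrimeSpectrum A → ℕ) (d : ℕ), (∀ p q, p < q → h q < h p) ∧ ∀ p, h p ≤ d := by
  have h1 : ∀ p : PrimeSpectrum A, (Order.coheight p : WithBot ℕ∞) ≤ ringKrullDim A :=
    fun p => Order.coheight_le_krullDim p
  obtain ⟨d, hd⟩ : ∃ d : ℕ, ringKrullDim A ≤ ((d : ℕ∞) : WithBot ℕ∞) := by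
    generalize ringKrullDim A = x at hdim
    induction x with
    | bot => exact ⟨0, bot_le⟩
    | coe x =>
      induction x with
      | top => exact absurd hdim (lt_irrefl _)
      | coe d => exact ⟨d, le_rfl⟩
  have h2 : ∀ p : PrimeSpectrum A, Order.coheight p ≤ (d : ℕ∞) :=
    fun p => WithBot.coe_le_coe.mp ((h1 p).trans hd)
  have h3 : ∀ p : PrimeSpectrum A, Order.coheight p < ⊤ :=
    fun p => (h2 p).trans_lt (ENat.natCast_lt_top d)
  refine ⟨fun p => (Order.coheight p).toNat, d, fun p q hpq => ?_, fun p => ?_⟩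
  · have h4 := Order.coheight_strictAnti hpq (h3 q)
    rw [← ENat.natCast_toNat (h3 p).ne, ← ENat.natCast_toNat (h3 q).ne] at h4
    exact_mod_cast h4
  · have h4 := h2 p
    rw [← ENat.natCast_toNat (h3 p).ne] at h4
    exact_mod_cast h4


def TacHomAcyc (A : Type u) [CommRing A] (X : ℤ → Type u)
    [∀ n, AddCommGroup (X n)] [∀ n, Module A (X n)]
    (d : ∀ n, X n →ₗ[A] X (n + 1)) (Q : Type u) [AddCommGroup Q] [Module A Q] : Prop :=
  ∀ (n : ℤ) (φ : X (n + 1) →ₗ[A] Q), (∀ x, φ (d n x) = 0) →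
    ∃ ψ : X (n + 1 + 1) →ₗ[A] Q, ∀ x, ψ (d (n + 1) x) = φ x

def TacV (A : Type u) [CommRing A] : ℕ → ∀ (F' F : Type u) [AddCommGroup F'] [Module A F']
    [AddCommGroup F] [Module A F], Prop
  | 0, F', F, _, _, _, _ => ∀ (Q : Type u) [AddCommGroup Q] [Module A Q], Module.Projective A Q →
      ∀ π : Q →ₗ[A] F', Function.Surjective π → ∀ φ : LinearMap.ker π →ₗ[A] F,
        ∃ ψ : Q →ₗ[A] F, ∀ x : LinearMap.ker π, ψ x.1 = φ x
  | n + 1, F', F, _, _, _, _ => ∀ (Q : Type u) [AddCommGroup Q] [Module A Q],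
      Module.Projective A Q → ∀ π : Q →ₗ[A] F', Function.Surjective π →
        TacV A n (LinearMap.ker π) F

theorem tac_ker_flat {A : Type u} [CommRing A] {Q F' : Type u} [AddCommGroup F'] [Module A F']
    [AddCommGroup Q] [Module A Q] [Module.Flat A Q] [Module.Flat A F'] (π : Q →ₗ[A] F')
    (hπ : Function.Surjective π) : Module.Flat A (LinearMap.ker π) := by
  rw [Module.Flat.iff_rTensor_injective']
  intro I
  have h1 : Function.Injective ((LinearMap.ker π).subtype.lTensor I) :=
    LinearMap.lTensor_injective_of_exact_of_flat π hπ _ Subtype.val_injective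
      (LinearMap.exact_subtype_ker_map π) I
  have h2 : Function.Injective (LinearMap.rTensor Q (Submodule.subtype I)) :=
    Module.Flat.rTensor_preserves_injective_linearMap _ Subtype.val_injective
  have h3 := h2.comp h1
  rw [← LinearMap.coe_comp, LinearMap.rTensor_comp_lTensor, ← LinearMap.lTensor_comp_rTensor,
    LinearMap.coe_comp] at h3
  exact h3.of_comp

theorem tac_V0_T {A : Type u} [CommRing A] {κ : Type u}
    (I N : κ → Type u) [∀ k, AddCommGroup (I k)] [∀ k, Module A (I k)]
    [∀ k, AddCommGroup (N k)] [∀ k, Module A (N k)]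
    (hN : ∀ k, Module.Injective A (N k))
    (F' : Type u) [AddCommGroup F'] [Module A F'] [Module.Flat A F'] :
    TacV A 0 F' (∀ k, I k →ₗ[A] N k) := by
  intro Q _ _ hQ π hπ φ
  have key : ∀ k, ∃ ψ : Q →ₗ[A] I k →ₗ[A] N k, ∀ x : LinearMap.ker π, ψ x.1 = φ x k := by
    intro k
    have h1 : Function.Injective ((LinearMap.ker π).subtype.lTensor (I k)) :=
      LinearMap.lTensor_injective_of_exact_of_flat π hπ _ Subtype.val_injective
        (LinearMap.exact_subtype_ker_map π) (I k)
    have := hN k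
    obtain ⟨θ, hθ⟩ := Module.Injective.extension_property A (N k) _ _ _ h1
      (TensorProduct.lift (LinearMap.flip (LinearMap.proj k ∘ₗ φ)))
    refine ⟨(TensorProduct.curry θ).flip, fun x => ?_⟩
    ext e
    have := DFunLike.congr_fun hθ (e ⊗ₜ x)
    simpa using this
  choose ψ hψ using key
  exact ⟨LinearMap.pi ψ, fun x => by funext k; exact hψ k x⟩

theorem tac_V_step {A : Type u} [CommRing A] {F T C : Type u} [AddCommGroup F] [Module A F]
    [AddCommGroup T] [Module A T] [AddCommGroup C] [Module A C]
    (hT : ∀ (F' : Type u) [AddCommGroup F'] [Module A F'] [Module.Flat A F'], TacV A 0 F' T)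
    (j : F →ₗ[A] T) (c : T →ₗ[A] C) (hj : Function.Injective j) (hc : Function.Surjective c)
    (hjc : Function.Exact j c) (n : ℕ) :
    ∀ (F' : Type u) [AddCommGroup F'] [Module A F'] [Module.Flat A F'],
      TacV A n F' C → TacV A (n + 1) F' F := by
  induction n with
  | zero =>
    intro F' _ _ _ hV Q _ _ hQ π hπ Q1 _ _ hQ1 π1 hπ1 φ
    have := tac_ker_flat π hπ
    obtain ⟨ψ1, hψ1⟩ := hT (LinearMap.ker π) Q1 hQ1 π1 hπ1 (j ∘ₗ φ)
    -- induced map on the kernel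
    have hle : LinearMap.ker π1 ≤ LinearMap.ker (c ∘ₗ ψ1) := by
      intro x hx
      have := hψ1 ⟨x, hx⟩
      simp only [LinearMap.mem_ker, LinearMap.comp_apply] at *
      rw [this]
      exact hjc.apply_apply_eq_zero _
    let e := LinearMap.quotKerEquivOfSurjective π1 hπ1
    let ξ : LinearMap.ker π →ₗ[A] C := ((LinearMap.ker π1).liftQ (c ∘ₗ ψ1) hle) ∘ₗ e.symm.toLinearMap
    have hξ : ∀ x, ξ (π1 x) = c (ψ1 x) := by
      intro x
      have : e.symm (π1 x) = (LinearMap.ker π1).mkQ x := by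
        rw [LinearEquiv.symm_apply_eq]; rfl
      simp [ξ, this]
    obtain ⟨χ, hχ⟩ := hV Q hQ π hπ ξ
    obtain ⟨χ', hχ'⟩ := Module.projective_lifting_property c χ hc
    let ψ2 : Q1 →ₗ[A] T := ψ1 - χ' ∘ₗ (LinearMap.ker π).subtype ∘ₗ π1
    have h2 : ∀ x, c (ψ2 x) = 0 := by
      intro x
      have h3 : c (χ' (π1 x).1) = χ (π1 x).1 := DFunLike.congr_fun hχ' _
      simp only [ψ2, LinearMap.sub_apply, LinearMap.comp_apply, map_sub, Submodule.subtype_apply]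
      rw [h3, hχ, hξ, sub_self]
    let ej := LinearEquiv.ofInjective j hj
    refine ⟨ej.symm.toLinearMap ∘ₗ LinearMap.codRestrict (LinearMap.range j) ψ2
      (fun x => (hjc _).mp (h2 x)), fun x => ?_⟩
    simp only [LinearMap.comp_apply, LinearEquiv.coe_coe]
    rw [LinearEquiv.symm_apply_eq]
    apply Subtype.ext
    have h4 : π1 x.1 = 0 := x.2
    change ψ1 x.1 - χ' (π1 x.1).1 = j (φ x)
    rw [h4, hψ1]
    simp
  | succ n ih =>
    intro F' _ _ _ hV Q _ _ hQ π hπ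
    have := tac_ker_flat π hπ
    exact ih _ (hV Q hQ π hπ)

theorem tac_flat_acyc_of_V {A : Type u} [CommRing A] (X : ℤ → Type u)
    [∀ n, AddCommGroup (X n)] [∀ n, Module A (X n)]
    (d : ∀ n, X n →ₗ[A] X (n + 1)) (hX : ∀ n, Module.Projective A (X n))
    (hd : ∀ n x, d (n + 1) (d n x) = 0)
    (hac : ∀ (Q : Type u) [AddCommGroup Q] [Module A Q], Module.Projective A Q →
      TacHomAcyc A X d Q) (n : ℕ) :
    ∀ (F' : Type u) [AddCommGroup F'] [Module A F'] [Module.Flat A F'],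
      (∀ (F : Type u) [AddCommGroup F] [Module A F] [Module.Flat A F], TacV A n F' F) →
      TacHomAcyc A X d F' := by
  induction n with
  | zero =>
    intro F' _ _ _ hV
    apply hac
    let π : (F' →₀ A) →ₗ[A] F' := Finsupp.linearCombination A id
    have hπ : Function.Surjective π := Finsupp.linearCombination_id_surjective A F'
    have := tac_ker_flat π hπ
    obtain ⟨ψ, hψ⟩ := hV (LinearMap.ker π) (F' →₀ A) inferInstance π hπ LinearMap.id
    -- section of π
    have hle : LinearMap.ker π ≤ LinearMap.ker (LinearMap.id - (LinearMap.ker π).subtype ∘ₗ ψ) := by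
      intro x hx
      have := hψ ⟨x, hx⟩
      simp only [LinearMap.id_apply] at this
      simp [this]
    let e := LinearMap.quotKerEquivOfSurjective π hπ
    let s : F' →ₗ[A] (F' →₀ A) := ((LinearMap.ker π).liftQ _ hle) ∘ₗ e.symm.toLinearMap
    refine Module.Projective.of_split s π ?_
    ext x
    obtain ⟨y, rfl⟩ := hπ x
    have h1 : e.symm (π y) = (LinearMap.ker π).mkQ y := by
      rw [LinearEquiv.symm_apply_eq]; rfl
    have h2 : π (ψ y).1 = 0 := (ψ y).2
    simp [s, h1, h2]
  | succ n ih =>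
    intro F' _ _ _ hV
    let Q := F' →₀ A
    let π : Q →ₗ[A] F' := Finsupp.linearCombination A id
    have hπ : Function.Surjective π := Finsupp.linearCombination_id_surjective A F'
    have := tac_ker_flat π hπ
    have hK := ih (LinearMap.ker π) (fun F _ _ _ => hV F Q inferInstance π hπ)
    have hQ := hac Q inferInstance
    intro m φ hφ
    obtain ⟨m, rfl⟩ : ∃ k, k + 1 = m := ⟨m - 1, by ring⟩
    obtain ⟨φ', hφ'⟩ := Module.projective_lifting_property π φ hπ
    have hφ'' : ∀ x, π (φ' x) = φ x := fun x => DFunLike.congr_fun hφ' x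
    obtain ⟨ψ, hψ⟩ := hK m (LinearMap.codRestrict (LinearMap.ker π) (φ' ∘ₗ d (m + 1)) (by
      intro x
      simp [hφ'', hφ])) (by
      intro x
      apply Subtype.ext
      simp [hd])
    have hψ' : ∀ x, (ψ (d (m + 1) x)).1 = φ' (d (m + 1) x) := fun x => congrArg Subtype.val (hψ x)
    obtain ⟨χ, hχ⟩ := hQ (m + 1) (φ' - (LinearMap.ker π).subtype ∘ₗ ψ) (by
      intro x
      simp [hψ'])
    refine ⟨π ∘ₗ χ, fun x => ?_⟩
    have h2 : π (ψ x).1 = 0 := (ψ x).2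
    simp [hχ, h2, hφ'']

theorem tac_flat_acyc {A : Type u} [CommRing A] [IsNoetherianRing A] (D : TacData A)
    (hdim : ringKrullDim A < ⊤) (X : ℤ → Type u)
    [∀ n, AddCommGroup (X n)] [∀ n, Module A (X n)]
    (d : ∀ n, X n →ₗ[A] X (n + 1)) (hX : ∀ n, Module.Projective A (X n))
    (hd : ∀ n x, d (n + 1) (d n x) = 0)
    (hac : ∀ (Q : Type u) [AddCommGroup Q] [Module A Q], Module.Projective A Q →
      TacHomAcyc A X d Q) (F' : Type u) [AddCommGroup F'] [Module A F'] [Module.Flat A F'] :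
    TacHomAcyc A X d F' := by
  obtain ⟨h, k, hh, hk⟩ := tac_height hdim
  refine tac_flat_acyc_of_V X d hX hd hac (k + 1) F' ?_
  intro F _ _ _
  refine tac_dev D h hh k hk (fun n F _ _ => ∀ (F' : Type u) [AddCommGroup F'] [Module A F']
    [Module.Flat A F'], TacV A n F' F) ?_ ?_ F F'
  · intro F _ _ _ F' _ _ _ Q _ _ _ π hπ φ
    exact ⟨0, fun x => Subsingleton.elim _ _⟩
  · intro n F _ _ _ κ pr N _ _ hN C _ _ _ j c hj hc hjc hC F' _ _ _
    exact tac_V_step (fun F' _ _ _ => tac_V0_T _ _ hN F') j c hj hc hjc n F' (hC F')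


noncomputable def tacSc {A : Type u} [CommRing A] {B : Type u} (v : B →₀ A)
    (M : Type u) [AddCommGroup M] [Module A M] : M →ₗ[A] (B →₀ M) where
  toFun m := v.mapRange (fun a => a • m) (zero_smul A m)
  map_add' x y := by ext b; simp
  map_smul' r x := by
    ext b
    change v b • (r • x) = r • (v b • x)
    exact smul_comm _ _ _

theorem tacSc_apply {A : Type u} [CommRing A] {B : Type u} (v : B →₀ A)
    (M : Type u) [AddCommGroup M] [Module A M] (m : M) (b : B) : tacSc v M m b = v b • m := rfl

noncomputable def tacD {A : Type u} [CommRing A] {B B' : Type u} (δ : B → (B' →₀ A))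
    (M : Type u) [AddCommGroup M] [Module A M] : (B →₀ M) →ₗ[A] (B' →₀ M) :=
  Finsupp.lsum A (fun b => tacSc (δ b) M)

theorem tacD_single {A : Type u} [CommRing A] {B B' : Type u} (δ : B → (B' →₀ A))
    (M : Type u) [AddCommGroup M] [Module A M] (b : B) (m : M) :
    tacD δ M (Finsupp.single b m) = tacSc (δ b) M m := by
  simp [tacD]

theorem tacSc_one {A : Type u} [CommRing A] {B : Type u} (v : B →₀ A) :
    tacSc v A 1 = v := by
  ext b; simp [tacSc_apply]

theorem tacD_single_one {A : Type u} [CommRing A] {B B' : Type u} (δ : B → (B' →₀ A)) (b : B) :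
    tacD δ A (Finsupp.single b 1) = δ b := by
  rw [tacD_single, tacSc_one]

theorem tacSc_add {A : Type u} [CommRing A] {B : Type u} (v w : B →₀ A)
    (M : Type u) [AddCommGroup M] [Module A M] (m : M) :
    tacSc (v + w) M m = tacSc v M m + tacSc w M m := by
  ext b; simp [tacSc_apply, add_smul]

theorem tacSc_zero {A : Type u} [CommRing A] {B : Type u}
    (M : Type u) [AddCommGroup M] [Module A M] (m : M) :
    tacSc (0 : B →₀ A) M m = 0 := by
  ext b; simp [tacSc_apply]

theorem tacSc_single {A : Type u} [CommRing A] {B : Type u} (b : B) (a : A)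
    (M : Type u) [AddCommGroup M] [Module A M] (m : M) :
    tacSc (Finsupp.single b a) M m = Finsupp.single b (a • m) := by
  ext b'
  classical
  simp only [tacSc_apply, Finsupp.single_apply]
  split_ifs <;> simp

/-- `tacD` commutes with scaling of vectors. -/
theorem tacD_sc {A : Type u} [CommRing A] {B B' : Type u} (δ : B → (B' →₀ A))
    (M : Type u) [AddCommGroup M] [Module A M] (v : B →₀ A) (m : M) :
    tacD δ M (tacSc v M m) = tacSc (tacD δ A v) M m := by
  induction v using Finsupp.induction_linear with
  | zero => simp [tacSc_zero]
  | add v w hv hw => rw [tacSc_add, map_add, map_add, tacSc_add, hv, hw]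
  | single b a =>
    rw [tacSc_single, tacD_single, tacD_single]
    ext b'
    simp [tacSc_apply, mul_smul]
    exact smul_comm _ _ _

noncomputable def tacHat {A : Type u} [CommRing A] {B E N : Type u} [AddCommGroup E] [Module A E]
    [AddCommGroup N] [Module A N] (φ : (B →₀ A) →ₗ[A] (E →ₗ[A] N)) : (B →₀ E) →ₗ[A] N :=
  Finsupp.lsum A (fun b => φ (Finsupp.single b 1))

noncomputable def tacUnhat {A : Type u} [CommRing A] {B E N : Type u} [AddCommGroup E] [Module A E]
    [AddCommGroup N] [Module A N] (χ : (B →₀ E) →ₗ[A] N) : (B →₀ A) →ₗ[A] (E →ₗ[A] N) :=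
  Finsupp.linearCombination A (fun b => χ ∘ₗ Finsupp.lsingle b)

theorem tacHat_sc {A : Type u} [CommRing A] {B E N : Type u} [AddCommGroup E] [Module A E]
    [AddCommGroup N] [Module A N] (φ : (B →₀ A) →ₗ[A] (E →ₗ[A] N)) (v : B →₀ A) (e : E) :
    tacHat φ (tacSc v E e) = φ v e := by
  induction v using Finsupp.induction_linear with
  | zero => simp [tacSc_zero]
  | add v w hv hw => rw [tacSc_add, map_add, map_add, hv, hw, LinearMap.add_apply]
  | single b a =>
    rw [tacSc_single]
    have : Finsupp.single b a = a • Finsupp.single b (1 : A) := by simp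
    rw [this, map_smul, LinearMap.smul_apply]
    simp [tacHat]

theorem tacUnhat_apply {A : Type u} [CommRing A] {B E N : Type u} [AddCommGroup E] [Module A E]
    [AddCommGroup N] [Module A N] (χ : (B →₀ E) →ₗ[A] N) (v : B →₀ A) (e : E) :
    tacUnhat χ v e = χ (tacSc v E e) := by
  induction v using Finsupp.induction_linear with
  | zero => simp [tacSc_zero]
  | add v w hv hw => rw [tacSc_add, map_add, map_add, LinearMap.add_apply, hv, hw]
  | single b a =>
    rw [tacSc_single]
    simp [tacUnhat]
    rw [← map_smul, Finsupp.smul_single]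

theorem tacHat_D {A : Type u} [CommRing A] {B B' E N : Type u} [AddCommGroup E] [Module A E]
    [AddCommGroup N] [Module A N] (δ : B → (B' →₀ A)) (φ : (B' →₀ A) →ₗ[A] (E →ₗ[A] N))
    (z : B →₀ E) : tacHat φ (tacD δ E z) = tacHat (φ ∘ₗ tacD δ A) z := by
  induction z using Finsupp.induction_linear with
  | zero => simp
  | add v w hv hw => rw [map_add, map_add, map_add, hv, hw]
  | single b e =>
    rw [tacD_single, tacHat_sc]
    simp [tacHat, tacD_single_one]

theorem tacHat_zero {A : Type u} [CommRing A] {B E N : Type u} [AddCommGroup E] [Module A E]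
    [AddCommGroup N] [Module A N] (z : B →₀ E) :
    tacHat (0 : (B →₀ A) →ₗ[A] (E →ₗ[A] N)) z = 0 := by
  induction z using Finsupp.induction_linear with
  | zero => simp
  | add v w hv hw => rw [map_add, hv, hw, add_zero]
  | single b e => simp [tacHat]

theorem tacHat_unhat {A : Type u} [CommRing A] {B E N : Type u} [AddCommGroup E] [Module A E]
    [AddCommGroup N] [Module A N] (χ : (B →₀ E) →ₗ[A] N) (z : B →₀ E) :
    tacHat (tacUnhat χ) z = χ z := by
  induction z using Finsupp.induction_linear with
  | zero => simp
  | add v w hv hw => rw [map_add, map_add, hv, hw]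
  | single b e =>
    simp [tacHat, tacUnhat]

def TacGood {A : Type u} [CommRing A] {ι : Type u} (J : ι → Type u) [∀ i, AddCommGroup (J i)]
    [∀ i, Module A (J i)] (B : ℤ → Type u) (δ : ∀ n, B n → (B (n + 1) →₀ A)) : Prop :=
  (∀ n b, tacD (δ (n + 1)) A (δ n b) = 0) ∧
  ∀ (i : ι) (n : ℤ) (z : B (n + 1) →₀ J i), tacD (δ (n + 1)) (J i) z = 0 →
    ∃ y, tacD (δ n) (J i) y = z

theorem tacD_D {A : Type u} [CommRing A] {B B' B'' : Type u} (δ : B → (B' →₀ A))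
    (δ' : B' → (B'' →₀ A)) (h : ∀ b, tacD δ' A (δ b) = 0)
    (M : Type u) [AddCommGroup M] [Module A M] (z : B →₀ M) : tacD δ' M (tacD δ M z) = 0 := by
  induction z using Finsupp.induction_linear with
  | zero => simp
  | add v w hv hw => rw [map_add, map_add, hv, hw, add_zero]
  | single b e => rw [tacD_single, tacD_sc, h, tacSc_zero]

def TacData.J {A : Type u} [CommRing A] (D : TacData A) : Option (PrimeSpectrum A) → Type u
  | none => A
  | some p => D.E p

instance TacData.Jacg {A : Type u} [CommRing A] (D : TacData A) : ∀ i, AddCommGroup (D.J i)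
  | none => inferInstanceAs (AddCommGroup A)
  | some p => inferInstanceAs (AddCommGroup (D.E p))

instance TacData.Jmod {A : Type u} [CommRing A] (D : TacData A) : ∀ i, Module A (D.J i)
  | none => inferInstanceAs (Module A A)
  | some p => inferInstanceAs (Module A (D.E p))

theorem tac_good_homAcyc_T {A : Type u} [CommRing A] (D : TacData A)
    (B : ℤ → Type u) (δ : ∀ n, B n → (B (n + 1) →₀ A)) (hg : TacGood D.J B δ)
    (κ : Type u) (pr : κ → PrimeSpectrum A) (N : κ → Type u) [∀ k, AddCommGroup (N k)]
    [∀ k, Module A (N k)] (hN : ∀ k, Module.Injective A (N k)) :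
    TacHomAcyc A (fun n => B n →₀ A) (fun n => tacD (δ n) A) (∀ k, D.E (pr k) →ₗ[A] N k) := by
  intro n φ hφ
  have key : ∀ k, ∃ ψ : (B (n + 1 + 1) →₀ A) →ₗ[A] (D.E (pr k) →ₗ[A] N k),
      ∀ x, ψ (tacD (δ (n + 1)) A x) = φ x k := by
    intro k
    let φk : (B (n + 1) →₀ A) →ₗ[A] (D.E (pr k) →ₗ[A] N k) := LinearMap.proj k ∘ₗ φ
    have hφk : φk ∘ₗ tacD (δ n) A = 0 := by
      ext b e
      have := hφ (Finsupp.single b 1)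
      simp [φk, this]
    obtain ⟨y, hy⟩ := tac_inj_factor (hN k) (tacD (δ (n + 1)) (D.E (pr k))) (tacHat φk) (by
      intro x hx
      obtain ⟨w, rfl⟩ := hg.2 (some (pr k)) n x hx
      refine (tacHat_D (δ n) φk w).trans ?_
      rw [hφk]
      exact tacHat_zero _)
    refine ⟨tacUnhat y, fun x => ?_⟩
    ext e
    rw [tacUnhat_apply, ← tacD_sc, hy, tacHat_sc]
    rfl
  choose ψ hψ using key
  exact ⟨LinearMap.pi ψ, fun x => by funext k; exact hψ k x⟩

theorem tac_good_homAcyc {A : Type u} [CommRing A] [IsNoetherianRing A]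
    (hdim : ringKrullDim A < ⊤) (D : TacData A)
    (B : ℤ → Type u) (δ : ∀ n, B n → (B (n + 1) →₀ A)) (hg : TacGood D.J B δ)
    (F : Type u) [AddCommGroup F] [Module A F] [Module.Flat A F] :
    TacHomAcyc A (fun n => B n →₀ A) (fun n => tacD (δ n) A) F := by
  obtain ⟨h, k, hh, hk⟩ := tac_height hdim
  refine tac_dev D h hh k hk (fun n F _ _ =>
    TacHomAcyc A (fun n => B n →₀ A) (fun n => tacD (δ n) A) F) ?_ ?_ F
  · intro F _ _ _ n φ hφ
    exact ⟨0, fun x => Subsingleton.elim _ _⟩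
  · intro _ F _ _ _ κ pr N _ _ hN C _ _ _ j c hj hc hjc hC n φ hφ
    obtain ⟨ψ, hψ⟩ := tac_good_homAcyc_T D B δ hg κ pr N hN n (j ∘ₗ φ) (by
      intro x; rw [LinearMap.comp_apply, hφ, map_zero])
    obtain ⟨χ, hχ⟩ := hC (n + 1) (c ∘ₗ ψ) (by
      intro x
      rw [LinearMap.comp_apply, hψ, LinearMap.comp_apply]
      exact hjc.apply_apply_eq_zero _)
    obtain ⟨χ', hχ'⟩ := Module.projective_lifting_property c χ hc
    have hχ'' : ∀ x, c (χ' x) = χ x := fun x => DFunLike.congr_fun hχ' x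
    let ψ2 : (B (n + 1 + 1) →₀ A) →ₗ[A] (∀ k, D.E (pr k) →ₗ[A] N k) :=
      ψ - χ' ∘ₗ tacD (δ (n + 1 + 1)) A
    let ej := LinearEquiv.ofInjective j hj
    refine ⟨ej.symm.toLinearMap ∘ₗ LinearMap.codRestrict (LinearMap.range j) ψ2
      (fun x => (hjc _).mp ?_), fun x => ?_⟩
    · have := hχ x
      simp only [ψ2, LinearMap.sub_apply, LinearMap.comp_apply, map_sub, hχ'']
      rw [this]; simp
    · simp only [LinearMap.comp_apply, LinearEquiv.coe_coe]
      rw [LinearEquiv.symm_apply_eq]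
      apply Subtype.ext
      change ψ (tacD (δ (n + 1)) A x) - χ' (tacD (δ (n + 1 + 1)) A (tacD (δ (n + 1)) A x)) = j (φ x)
      rw [hψ, tacD_D _ _ (hg.1 _), map_zero, sub_zero]
      rfl

theorem tac_good_of_acyc {A : Type u} [CommRing A] [IsNoetherianRing A]
    (hdim : ringKrullDim A < ⊤) (D : TacData A)
    (B : ℤ → Type u) (δ : ∀ n, B n → (B (n + 1) →₀ A))
    (h0 : ∀ n b, tacD (δ (n + 1)) A (δ n b) = 0)
    (h1 : ∀ n (z : B (n + 1) →₀ A), tacD (δ (n + 1)) A z = 0 → ∃ y, tacD (δ n) A y = z)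
    (hac : ∀ (Q : Type u) [AddCommGroup Q] [Module A Q], Module.Projective A Q →
      TacHomAcyc A (fun n => B n →₀ A) (fun n => tacD (δ n) A) Q) :
    TacGood D.J B δ := by
  refine ⟨h0, fun i => ?_⟩
  rcases i with _ | p
  · exact h1
  intro n z hz
  change B (n + 1) →₀ D.E p at z
  by_contra hcon
  have hzr : z ∉ LinearMap.range (tacD (δ n) (D.E p)) := fun ⟨y, hy⟩ => hcon ⟨y, hy⟩
  obtain ⟨N, _, _, j, hN, hj⟩ := tac_exists_inj A
    ((B (n + 1) →₀ D.E p) ⧸ LinearMap.range (tacD (δ n) (D.E p)))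
  let χ := j ∘ₗ (LinearMap.range (tacD (δ n) (D.E p))).mkQ
  have hχz : χ z ≠ 0 := by
    intro h
    apply hzr
    have := (map_eq_zero_iff j hj).mp h
    simpa using this
  have hχ : ∀ y, χ (tacD (δ n) (D.E p) y) = 0 := by
    intro y
    have : (LinearMap.range (tacD (δ n) (D.E p))).mkQ (tacD (δ n) (D.E p) y) = 0 := by simp
    simp only [χ, LinearMap.comp_apply, this, map_zero]
  have hflat : Module.Flat A (D.E p →ₗ[A] N) := by
    have := tac_H_flat (κ := PUnit.{u+1}) (fun _ => D.E p) (fun _ => N) (fun _ => D.inj p) (fun _ => hN)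
    exact Module.Flat.of_retract (LinearMap.pi fun _ : PUnit.{u+1} => LinearMap.id)
      (LinearMap.proj PUnit.unit) rfl
  have hX := tac_flat_acyc D hdim (fun n => B n →₀ A) (fun n => tacD (δ n) A)
    (fun n => inferInstance) (fun n x => tacD_D _ _ (h0 n) A x) hac (D.E p →ₗ[A] N)
  obtain ⟨ψ, hψ⟩ := hX n (tacUnhat χ) (by
    intro x
    ext e
    rw [tacUnhat_apply, ← tacD_sc, hχ]
    rfl)
  apply hχz
  rw [← tacHat_unhat χ z]
  have : tacUnhat χ = ψ ∘ₗ tacD (δ (n + 1)) A := by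
    apply LinearMap.ext
    intro x
    exact (hψ x).symm
  rw [this, ← tacHat_D]
  have hz' : tacD (δ (n + 1)) (D.E p) z = 0 := hz
  rw [hz', map_zero]


theorem tacD_apply {A : Type u} [CommRing A] {B B' : Type u} (δ : B → (B' →₀ A))
    (M : Type u) [AddCommGroup M] [Module A M] (z : B →₀ M) (b' : B') :
    tacD δ M z b' = z.sum (fun b m => δ b b' • m) := by
  simp only [tacD, Finsupp.lsum_apply, Finsupp.sum_apply]
  rfl

theorem tacD_supp {A : Type u} [CommRing A] {B B' : Type u} (δ : B → (B' →₀ A))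
    (M : Type u) [AddCommGroup M] [Module A M] (z : B →₀ M) (b' : B')
    (h : ∀ b, z b ≠ 0 → δ b b' = 0) : tacD δ M z b' = 0 := by
  rw [tacD_apply]
  refine Finset.sum_eq_zero fun b hb => ?_
  change δ b b' • z b = 0
  rw [h b (Finsupp.mem_support_iff.mp hb), zero_smul]

theorem tacD_map {A : Type u} [CommRing A] {B C C' : Type u} (δ : C → (C' →₀ A)) (g : B → C)
    (M : Type u) [AddCommGroup M] [Module A M] (z : B →₀ M) :
    tacD δ M (Finsupp.mapDomain g z) = tacD (fun b => δ (g b)) M z := by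
  induction z using Finsupp.induction_linear with
  | zero => simp
  | add v w hv hw => rw [Finsupp.mapDomain_add, map_add, map_add, hv, hw]
  | single b e => rw [Finsupp.mapDomain_single, tacD_single, tacD_single]

theorem tacSc_map {A : Type u} [CommRing A] {B C : Type u} (g : B → C) (v : B →₀ A)
    (M : Type u) [AddCommGroup M] [Module A M] (m : M) :
    tacSc (Finsupp.mapDomain g v) M m = Finsupp.mapDomain g (tacSc v M m) := by
  induction v using Finsupp.induction_linear with
  | zero => simp [tacSc_zero]
  | add v w hv hw => rw [Finsupp.mapDomain_add, tacSc_add, tacSc_add, Finsupp.mapDomain_add, hv, hw]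
  | single b e =>
    rw [Finsupp.mapDomain_single, tacSc_single, tacSc_single, Finsupp.mapDomain_single]

theorem tacD_map_left {A : Type u} [CommRing A] {B C C' : Type u} (δ : B → (C →₀ A)) (g : C → C')
    (M : Type u) [AddCommGroup M] [Module A M] (z : B →₀ M) :
    tacD (fun b => Finsupp.mapDomain g (δ b)) M z = Finsupp.mapDomain g (tacD δ M z) := by
  induction z using Finsupp.induction_linear with
  | zero => simp
  | add v w hv hw => rw [map_add, map_add, Finsupp.mapDomain_add, hv, hw]
  | single b e => rw [tacD_single, tacD_single, tacSc_map]

theorem tacD_sub {A : Type u} [CommRing A] {B C : Type u} (δ δ' : B → (C →₀ A))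
    (M : Type u) [AddCommGroup M] [Module A M] (z : B →₀ M) :
    tacD (fun b => δ b - δ' b) M z = tacD δ M z - tacD δ' M z := by
  induction z using Finsupp.induction_linear with
  | zero => simp
  | add v w hv hw => rw [map_add, map_add, map_add, hv, hw]; abel
  | single b e =>
    rw [tacD_single, tacD_single, tacD_single]
    ext c
    simp [tacSc_apply, sub_smul]

theorem tacD_eq_lc {A : Type u} [CommRing A] {B C : Type u} (δ : B → (C →₀ A)) :
    tacD δ A = Finsupp.linearCombination A δ := by
  ext b : 2
  simp [tacD_single_one]

/-- good subsets of a based complex -/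
def TacGoodOn {A : Type u} [CommRing A] {ι : Type u} (J : ι → Type u) [∀ i, AddCommGroup (J i)]
    [∀ i, Module A (J i)] (B : ℤ → Type u) (δ : ∀ n, B n → (B (n + 1) →₀ A))
    (U : ∀ n, Set (B n)) : Prop :=
  ∀ (i : ι) (n : ℤ) (z : B (n + 1) →₀ J i), (∀ b, b ∉ U (n + 1) → z b = 0) →
    tacD (δ (n + 1)) (J i) z = 0 →
    ∃ y : B n →₀ J i, (∀ b, b ∉ U n → y b = 0) ∧ tacD (δ n) (J i) y = z

theorem tac_sub_ext {B M : Type u} [AddCommGroup M] (U : Set B) (z : B →₀ M)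
    (h : ∀ b, b ∉ U → z b = 0) :
    Finsupp.mapDomain Subtype.val (z.subtypeDomain (· ∈ U)) = z := by
  ext b
  by_cases hb : b ∈ U
  · exact (Finsupp.mapDomain_apply Subtype.val_injective _ ⟨b, hb⟩)
  · rw [h b hb, Finsupp.mapDomain_of_notMem_range]
    rintro ⟨x, rfl⟩
    exact hb x.2

theorem tac_restrict_good {A : Type u} [CommRing A] {ι : Type u} (J : ι → Type u)
    [∀ i, AddCommGroup (J i)]
    [∀ i, Module A (J i)] (B : ℤ → Type u) (δ : ∀ n, B n → (B (n + 1) →₀ A))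
    (U : ∀ n, Set (B n)) (hU : ∀ n, ∀ b ∈ U n, ∀ b', b' ∉ U (n + 1) → δ n b b' = 0)
    (h0 : ∀ n, ∀ b ∈ U n, tacD (δ (n + 1)) A (δ n b) = 0)
    (hg : TacGoodOn J B δ U) :
    TacGood J (fun n => U n)
      (fun n b => (δ n b.1).subtypeDomain (· ∈ U (n + 1))) := by
  have key : ∀ (n : ℤ) (M : Type u) [AddCommGroup M] [Module A M] (z : U n →₀ M),
      Finsupp.mapDomain Subtype.val
        (tacD (fun b : U n => (δ n b.1).subtypeDomain (· ∈ U (n + 1))) M z) =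
      tacD (δ n) M (Finsupp.mapDomain Subtype.val z) := by
    intro n M _ _ z
    rw [tacD_map, ← tacD_map_left]
    congr 1
    congr 1
    funext b
    exact tac_sub_ext _ _ (hU n b.1 b.2)
  refine ⟨fun n b => ?_, fun i n z hz => ?_⟩
  · apply Finsupp.mapDomain_injective (Subtype.val_injective)
    rw [key, tac_sub_ext _ _ (hU n b.1 b.2), h0 n b.1 b.2, Finsupp.mapDomain_zero]
  · obtain ⟨y, hy, hyz⟩ := hg i n (Finsupp.mapDomain Subtype.val z) (fun b hb => by
      rw [Finsupp.mapDomain_of_notMem_range]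
      rintro ⟨x, rfl⟩
      exact hb x.2) (by rw [← key, hz, Finsupp.mapDomain_zero])
    refine ⟨y.subtypeDomain (· ∈ U n), ?_⟩
    apply Finsupp.mapDomain_injective (Subtype.val_injective)
    rw [key, tac_sub_ext _ _ hy, hyz]


theorem tac_filtered_good {A : Type u} [CommRing A] {ι : Type u} (J : ι → Type u)
    [∀ i, AddCommGroup (J i)] [∀ i, Module A (J i)] {G : Type u} [LinearOrder G]
    [WellFoundedLT G] (C : G → ℤ → Type u)
    (δC : ∀ e n, C e n → (C e (n + 1) →₀ A)) (hC : ∀ e, TacGood J (C e) (δC e))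
    (f : ∀ e n, C e n → ((Σ e, C e (n + 1)) →₀ A))
    (hf : ∀ e n b x, f e n b x ≠ 0 → x.1 < e)
    (h0 : ∀ n x, tacD (fun x : (Σ e, C e (n + 1)) =>
      Finsupp.mapDomain (Sigma.mk x.1) (δC x.1 (n + 1) x.2) - f x.1 (n + 1) x.2) A
      ((fun x : (Σ e, C e n) =>
      Finsupp.mapDomain (Sigma.mk x.1) (δC x.1 n x.2) - f x.1 n x.2) x) = 0) :
    TacGood J (fun n => Σ e, C e n) (fun n x =>
      Finsupp.mapDomain (Sigma.mk x.1) (δC x.1 n x.2) - f x.1 n x.2) := by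
  refine ⟨h0, fun i n => ?_⟩
  -- the differential on a component
  have hD : ∀ e n (y : C e n →₀ J i), tacD (fun x : (Σ e, C e n) =>
      Finsupp.mapDomain (Sigma.mk x.1) (δC x.1 n x.2) - f x.1 n x.2) (J i)
        (Finsupp.mapDomain (Sigma.mk e) y) =
      Finsupp.mapDomain (Sigma.mk e) (tacD (δC e n) (J i) y) - tacD (f e n) (J i) y := by
    intro e n y
    rw [tacD_map, tacD_sub, ← tacD_map_left]
  have hDv : ∀ e n (y : C e n →₀ J i) (x : Σ e, C e (n + 1)), e ≤ x.1 →
      tacD (f e n) (J i) y x = 0 := by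
    intro e n y x hx
    apply tacD_supp
    intro b _
    by_contra h
    exact absurd (hf e n b x h) (not_lt.mpr hx)
  have main : ∀ (e : G) (z : (Σ e, C e (n + 1)) →₀ J i), (∀ x, z x ≠ 0 → x.1 ≤ e) →
      tacD (fun x : (Σ e, C e (n + 1)) =>
      Finsupp.mapDomain (Sigma.mk x.1) (δC x.1 (n + 1) x.2) - f x.1 (n + 1) x.2) (J i) z = 0 →
      ∃ y, tacD (fun x : (Σ e, C e n) =>
      Finsupp.mapDomain (Sigma.mk x.1) (δC x.1 n x.2) - f x.1 n x.2) (J i) y = z := by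
    intro e
    induction e using WellFoundedLT.induction with
    | ind e ih =>
    intro z hz hz0
    -- the top component
    have hze : tacD (δC e (n + 1)) (J i) (z.split e) = 0 := by
      ext b
      have h1 := DFunLike.congr_fun hz0 ⟨e, b⟩
      have h2 : z = Finsupp.mapDomain (Sigma.mk e) (z.split e) +
        (z - Finsupp.mapDomain (Sigma.mk e) (z.split e)) := by abel
      rw [h2, map_add, hD, Finsupp.add_apply, Finsupp.sub_apply,
        Finsupp.mapDomain_apply sigma_mk_injective, hDv e _ _ ⟨e, b⟩ le_rfl] at h1
      refine Eq.trans ?_ h1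
      rw [sub_zero, left_eq_add]
      apply tacD_supp
      · rintro ⟨e', b'⟩ hb'
        have hlt : e' < e := by
          rcases lt_trichotomy e' e with h | h | h
          · exact h
          · subst h
            exfalso
            apply hb'
            rw [Finsupp.sub_apply, Finsupp.mapDomain_apply sigma_mk_injective,
              Finsupp.split_apply, sub_self]
          · exfalso
            apply hb'
            rw [Finsupp.sub_apply, Finsupp.mapDomain_of_notMem_range]
            · rw [sub_zero]
              by_contra hne
              exact absurd (hz _ hne) (not_le.mpr h)
            · rintro ⟨c, hc⟩
              cases hc
              exact lt_irrefl _ h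
        simp only [Finsupp.sub_apply]
        rw [Finsupp.mapDomain_of_notMem_range, zero_sub, neg_eq_zero]
        · by_contra hne
          exact absurd (hf _ _ _ _ hne) (not_lt.mpr hlt.le)
        · rintro ⟨c, hc⟩
          cases hc
          exact lt_irrefl _ hlt
    obtain ⟨y, hy⟩ := (hC e).2 i n _ hze
    let z' := z - tacD (fun x : (Σ e, C e n) =>
      Finsupp.mapDomain (Sigma.mk x.1) (δC x.1 n x.2) - f x.1 n x.2) (J i)
        (Finsupp.mapDomain (Sigma.mk e) y)
    have hz'lt : ∀ x, z' x ≠ 0 → x.1 < e := by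
      rintro ⟨e', b'⟩ hb'
      rcases lt_trichotomy e' e with h | h | h
      · exact h
      · subst h
        exfalso
        apply hb'
        simp only [z']
        rw [hD, Finsupp.sub_apply, Finsupp.sub_apply, Finsupp.mapDomain_apply sigma_mk_injective,
          hDv e' _ _ ⟨e', b'⟩ le_rfl, hy, Finsupp.split_apply, sub_zero, sub_self]
      · exfalso
        apply hb'
        simp only [z']
        rw [hD, Finsupp.sub_apply, Finsupp.sub_apply, Finsupp.mapDomain_of_notMem_range,
          hDv e _ _ ⟨e', b'⟩ h.le, sub_zero, sub_zero]
        · by_contra hne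
          exact absurd (hz _ hne) (not_le.mpr h)
        · rintro ⟨c, hc⟩
          cases hc
          exact lt_irrefl _ h
    have hz'0 : tacD (fun x : (Σ e, C e (n + 1)) =>
      Finsupp.mapDomain (Sigma.mk x.1) (δC x.1 (n + 1) x.2) - f x.1 (n + 1) x.2) (J i) z' = 0 := by
      simp only [z']
      rw [map_sub, hz0, tacD_D _ _ (h0 n), sub_zero]
    have : ∃ y', tacD (fun x : (Σ e, C e n) =>
      Finsupp.mapDomain (Sigma.mk x.1) (δC x.1 n x.2) - f x.1 n x.2) (J i) y' = z' := by
      by_cases hne : z' = 0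
      · exact ⟨0, by rw [hne, map_zero]⟩
      · have hs : z'.support.Nonempty := Finsupp.support_nonempty_iff.mpr hne
        obtain ⟨x, hx, hmax⟩ := z'.support.exists_max_image (fun x => x.1) hs
        exact ih x.1 (hz'lt x (Finsupp.mem_support_iff.mp hx)) z'
          (fun w hw => hmax w (Finsupp.mem_support_iff.mpr hw)) hz'0
    obtain ⟨y', hy'⟩ := this
    refine ⟨y' + Finsupp.mapDomain (Sigma.mk e) y, ?_⟩
    rw [map_add, hy']
    simp only [z']
    abel
  intro z hz0
  by_cases hne : z = 0
  · exact ⟨0, by rw [hne, map_zero]⟩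
  · have hs : z.support.Nonempty := Finsupp.support_nonempty_iff.mpr hne
    obtain ⟨x, hx, hmax⟩ := z.support.exists_max_image (fun x => x.1) hs
    exact main x.1 z
      (fun w hw => hmax w (Finsupp.mem_support_iff.mpr hw)) hz0


inductive TacL (A : Type u) (K : Type u) (B : K → ℤ → Type u) (P : ℤ → Type u) : ℤ → Type u
  | mk (S : K) (N : ∀ n, B S n → ℕ) (c : ∀ n b, Fin (N n b) → A)
      (ch : ∀ n b, Fin (N n b) → TacL A K B P (n + 1)) (p : ∀ n, B S n → P n)
      (n : ℤ) (b : B S n) : TacL A K B P n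

structure TacG (A : Type u) (K : Type u) (B : K → ℤ → Type u) (P : ℤ → Type u) : Type u where
  S : K
  N : ∀ n, B S n → ℕ
  c : ∀ n b, Fin (N n b) → A
  ch : ∀ n b, Fin (N n b) → TacL A K B P (n + 1)
  p : ∀ n, B S n → P n

abbrev TacR (A : Type u) (K : Type u) (B : K → ℤ → Type u) (P : ℤ → Type u) (n : ℤ) : Type u :=
  Σ e : TacG A K B P, B e.S n

def TacL.toR {A K : Type u} {B : K → ℤ → Type u} {P : ℤ → Type u} {n : ℤ} :
    TacL A K B P n → TacR A K B P n
  | .mk S N c ch p _ b => ⟨⟨S, N, c, ch, p⟩, b⟩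

def TacR.toL {A K : Type u} {B : K → ℤ → Type u} {P : ℤ → Type u} {n : ℤ}
    (x : TacR A K B P n) : TacL A K B P n :=
  .mk x.1.S x.1.N x.1.c x.1.ch x.1.p n x.2

theorem TacR.toR_toL {A K : Type u} {B : K → ℤ → Type u} {P : ℤ → Type u} {n : ℤ}
    (x : TacR A K B P n) : (TacR.toL x).toR = x := rfl

def TacG.rel {A K : Type u} {B : K → ℤ → Type u} {P : ℤ → Type u} (e' e : TacG A K B P) : Prop :=
  ∃ n b i, (e.ch n b i).toR.1 = e'

theorem TacG.wf {A K : Type u} {B : K → ℤ → Type u} {P : ℤ → Type u} :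
    WellFounded (TacG.rel (A := A) (B := B) (P := P)) := by
  have h : ∀ n (w : TacL A K B P n), Acc TacG.rel w.toR.1 := by
    intro n w
    induction w with
    | mk S N c ch p n b ih =>
      refine ⟨_, ?_⟩
      rintro e' ⟨m, b', i, rfl⟩
      exact ih m b' i
  refine ⟨fun e => ⟨_, ?_⟩⟩
  rintro e' ⟨m, b', i, rfl⟩
  exact h _ _

noncomputable def TacG.fT {A K : Type u} [CommRing A] {B : K → ℤ → Type u} {P : ℤ → Type u}
    (e : TacG A K B P) (n : ℤ) (b : B e.S n) : TacR A K B P (n + 1) →₀ A :=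
  ∑ i, Finsupp.single (e.ch n b i).toR (e.c n b i)

noncomputable def tacRd {A K : Type u} [CommRing A] {B : K → ℤ → Type u} {P : ℤ → Type u}
    (δ : ∀ S n, B S n → (B S (n + 1) →₀ A)) (n : ℤ) (x : TacR A K B P n) :
    TacR A K B P (n + 1) →₀ A :=
  Finsupp.mapDomain (Sigma.mk x.1) (δ x.1.S n x.2) - x.1.fT n x.2

inductive TacVal {A K : Type u} [CommRing A] {B : K → ℤ → Type u} {P : ℤ → Type u}
    [∀ n, AddCommGroup (P n)] [∀ n, Module A (P n)] (dP : ∀ n, P n →ₗ[A] P (n + 1))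
    (δ : ∀ S n, B S n → (B S (n + 1) →₀ A)) : TacG A K B P → Prop
  | mk (e : TacG A K B P) (h : ∀ n b i, TacVal dP δ (e.ch n b i).toR.1)
      (h1 : ∀ n b, tacD (e.fT (n + 1)) A (δ e.S n b) = - tacD (tacRd δ (n + 1)) A (e.fT n b))
      (h2 : ∀ n b, Finsupp.linearCombination A (e.p (n + 1)) (δ e.S n b) =
        Finsupp.linearCombination A (fun x : TacR A K B P (n + 1) => x.1.p (n + 1) x.2)
          (e.fT n b) + dP n (e.p n b)) : TacVal dP δ e

set_option maxHeartbeats 400000 in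
theorem tac_partIII {A : Type u} [CommRing A] {ι : Type u} (J : ι → Type u)
    [∀ i, AddCommGroup (J i)] [∀ i, Module A (J i)] (K : Type u) (B : K → ℤ → Type u)
    (δ : ∀ S n, B S n → (B S (n + 1) →₀ A)) (hgood : ∀ S, TacGood J (B S) (δ S))
    (P : ℤ → Type u) [∀ n, AddCommGroup (P n)] [∀ n, Module A (P n)]
    (dP : ∀ n, P n →ₗ[A] P (n + 1)) :
    ∃ (V : ℤ → Type u) (δV : ∀ n, V n → (V (n + 1) →₀ A)) (t : ∀ n, V n → P n),
      TacGood J V δV ∧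
      (∀ n v, Finsupp.linearCombination A (t (n + 1)) (δV n v) = dP n (t n v)) ∧
      ∀ (S : K) (fT : ∀ n, B S n → (V (n + 1) →₀ A)) (fP : ∀ n, B S n → P n),
        (∀ n b, tacD (fT (n + 1)) A (δ S n b) = - tacD (δV (n + 1)) A (fT n b)) →
        (∀ n b, Finsupp.linearCombination A (fP (n + 1)) (δ S n b) =
          Finsupp.linearCombination A (t (n + 1)) (fT n b) + dP n (fP n b)) →
        ∃ s : ∀ n, B S n → V n,
          (∀ n b, fT n b = Finsupp.mapDomain (s (n + 1)) (δ S n b) - δV n (s n b)) ∧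
          (∀ n b, fP n b = t n (s n b)) := by
  let G := {e : TacG A K B P // TacVal dP δ e}
  haveI : IsWellFounded (TacG A K B P) TacG.rel := ⟨TacG.wf⟩
  letI L0 : LinearOrder (TacG A K B P) := IsWellFounded.wellOrderExtension TacG.rel
  have hlt : ∀ e e' : TacG A K B P, TacG.rel e e' → e < e' := fun e e' h =>
    Prod.Lex.left _ _ (IsWellFounded.rank_lt_of_rel h)
  haveI : WellFoundedLT (TacG A K B P) := IsWellFounded.wellOrderExtension.isWellFounded_lt TacG.rel
  let C : G → ℤ → Type u := fun e n => B e.1.S n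
  let δC : ∀ (e : G) n, C e n → (C e (n + 1) →₀ A) := fun e n b => δ e.1.S n b
  have hv : ∀ (e : G) n b i, TacVal dP δ (e.1.ch n b i).toR.1 := by
    rintro ⟨e, he⟩
    cases he with
    | mk _ h h1 h2 => exact h
  let f : ∀ (e : G) n, C e n → ((Σ e : G, C e (n + 1)) →₀ A) := fun e n b =>
    ∑ i, Finsupp.single (⟨⟨(e.1.ch n b i).toR.1, hv e n b i⟩, (e.1.ch n b i).toR.2⟩ :
      Σ e : G, C e (n + 1)) (e.1.c n b i)
  let inc : ∀ n, (Σ e : G, C e n) → TacR A K B P n := fun n x => ⟨x.1.1, x.2⟩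
  have hinc : ∀ n, Function.Injective (inc n) := by
    rintro n ⟨⟨e, he⟩, b⟩ ⟨⟨e', he'⟩, b'⟩ h
    cases h
    rfl
  let δV : ∀ n, (Σ e : G, C e n) → ((Σ e : G, C e (n + 1)) →₀ A) := fun n x =>
      Finsupp.mapDomain (Sigma.mk x.1) (δC x.1 n x.2) - f x.1 n x.2
  let t : ∀ n, (Σ e : G, C e n) → P n := fun n x => x.1.1.p n x.2
  have hf : ∀ (e : G) n b, Finsupp.mapDomain (inc (n + 1)) (f e n b) = e.1.fT n b := by
    intro e n b
    simp only [f, TacG.fT]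
    rw [Finsupp.mapDomain_finset_sum]
    simp only [Finsupp.mapDomain_single]
    rfl
  have hδ : ∀ n x, Finsupp.mapDomain (inc (n + 1)) (δV n x) = tacRd δ n (inc n x) := by
    intro n x
    have : Finsupp.mapDomain (inc (n + 1)) (Finsupp.mapDomain (Sigma.mk x.1) (δC x.1 n x.2)) =
      Finsupp.mapDomain (Sigma.mk x.1.1) (δ x.1.1.S n x.2) := by
      rw [← Finsupp.mapDomain_comp]; rfl
    simp only [δV, tacRd]
    rw [← this, ← hf]
    exact map_sub (Finsupp.lmapDomain A A (inc (n + 1))) _ _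
  have e1 : ∀ (e : G) n b, tacD (f e (n + 1)) A (δC e n b) = - tacD (δV (n + 1)) A (f e n b) := by
    intro e n b
    have h1 : ∀ n b, tacD (e.1.fT (n + 1)) A (δ e.1.S n b) =
        - tacD (tacRd δ (n + 1)) A (e.1.fT n b) := by
      rcases e with ⟨e, he⟩
      cases he with
      | mk _ h h1 h2 => exact h1
    apply Finsupp.mapDomain_injective (hinc _)
    rw [← tacD_map_left]
    simp_rw [hf]
    rw [show δC e n b = δ e.1.S n b from rfl, h1, ← hf, tacD_map]
    simp_rw [← hδ]
    rw [tacD_map_left]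
    exact (map_neg (Finsupp.lmapDomain A A (inc (n + 1 + 1))) _).symm
  have e2 : ∀ (e : G) n b, Finsupp.linearCombination A (e.1.p (n + 1)) (δC e n b) =
      Finsupp.linearCombination A (t (n + 1)) (f e n b) + dP n (e.1.p n b) := by
    intro e n b
    have h2 : ∀ n b, Finsupp.linearCombination A (e.1.p (n + 1)) (δ e.1.S n b) =
        Finsupp.linearCombination A (fun x : TacR A K B P (n + 1) => x.1.p (n + 1) x.2)
          (e.1.fT n b) + dP n (e.1.p n b) := by
      rcases e with ⟨e, he⟩
      cases he with
      | mk _ h h1 h2 => exact h2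
    rw [show δC e n b = δ e.1.S n b from rfl, h2, ← hf, Finsupp.linearCombination_mapDomain]
    rfl
  have hdd : ∀ n x, tacD (δV (n + 1)) A (δV n x) = 0 := by
    rintro n ⟨e, b⟩
    have h3 : tacD (fun b => δV (n + 1) (Sigma.mk e b)) A (δC e n b) =
        Finsupp.mapDomain (Sigma.mk e) (tacD (δC e (n + 1)) A (δC e n b)) -
          tacD (f e (n + 1)) A (δC e n b) := by
      rw [← tacD_map_left, ← tacD_sub]
    have h4 : tacD (δC e (n + 1)) A (δC e n b) = 0 := (hgood e.1.S).1 n b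
    have h5 : δV n ⟨e, b⟩ = Finsupp.mapDomain (Sigma.mk e) (δC e n b) - f e n b := rfl
    rw [h5, map_sub, tacD_map, h3, h4, e1, Finsupp.mapDomain_zero]
    abel
  refine ⟨fun n => Σ e : G, C e n, δV, t, ?_, ?_, ?_⟩
  · refine tac_filtered_good J C δC (fun e => hgood e.1.S) f ?_ ?_
    · intro e n b x hx
      have : ∃ i, (⟨⟨(e.1.ch n b i).toR.1, hv e n b i⟩, (e.1.ch n b i).toR.2⟩ :
          Σ e : G, C e (n + 1)) = x := by
        by_contra hcon
        push Not at hcon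
        apply hx
        simp only [f]
        rw [Finsupp.finset_sum_apply]
        refine Finset.sum_eq_zero fun i _ => ?_
        classical
        rw [Finsupp.single_apply, if_neg (hcon i)]
      obtain ⟨i, rfl⟩ := this
      exact hlt _ _ ⟨n, b, i, rfl⟩
    · exact hdd
  · rintro n ⟨e, b⟩
    change Finsupp.linearCombination A (t (n + 1))
      (Finsupp.mapDomain (Sigma.mk e) (δC e n b) - f e n b) = dP n (e.1.p n b)
    rw [map_sub, Finsupp.linearCombination_mapDomain]
    change Finsupp.linearCombination A (e.1.p (n + 1)) (δC e n b) - _ = _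
    rw [e2]
    abel
  · intro S fT fP h1 h2
    let e : TacG A K B P :=
      { S := S
        N := fun n b => (fT n b).support.card
        c := fun n b i => fT n b ((fT n b).support.equivFin.symm i).1
        ch := fun n b i => TacR.toL (inc (n + 1) ((fT n b).support.equivFin.symm i).1)
        p := fP }
    have hsum : ∀ n b, (∑ i, Finsupp.single ((fT n b).support.equivFin.symm i).1
        (fT n b ((fT n b).support.equivFin.symm i).1)) = fT n b := by
      intro n b
      rw [Equiv.sum_comp (fT n b).support.equivFin.symm
        (fun x => Finsupp.single x.1 (fT n b x.1)),
        Finset.sum_coe_sort (fT n b).support (fun x => Finsupp.single x (fT n b x))]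
      exact Finsupp.sum_single _
    have hefT : ∀ n b, e.fT n b = Finsupp.mapDomain (inc (n + 1)) (fT n b) := by
      intro n b
      conv_rhs => rw [← hsum n b]
      rw [Finsupp.mapDomain_finset_sum]
      simp only [Finsupp.mapDomain_single]
      rfl
    have hval : TacVal dP δ e := by
      refine TacVal.mk e ?_ ?_ ?_
      · intro n b i
        exact ((fT n b).support.equivFin.symm i).1.1.2
      · intro n b
        rw [show e.fT (n + 1) = fun b => _ from funext (hefT (n + 1)), hefT, tacD_map_left,
          tacD_map]
        simp_rw [← hδ]
        rw [tacD_map_left]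
        refine (congrArg _ (h1 n b)).trans ?_
        exact (map_neg (Finsupp.lmapDomain A A (inc (n + 1 + 1))) _)
      · intro n b
        rw [hefT, Finsupp.linearCombination_mapDomain]
        exact h2 n b
    refine ⟨fun n b => ⟨⟨e, hval⟩, b⟩, fun n b => ?_, fun n b => rfl⟩
    have : f ⟨e, hval⟩ n b = fT n b := by
      apply Finsupp.mapDomain_injective (hinc _)
      rw [hf, ← hefT]
    change _ = _ - (Finsupp.mapDomain (Sigma.mk (⟨e, hval⟩ : G)) (δ S n b) - f ⟨e, hval⟩ n b)
    rw [this]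
    exact (sub_sub_cancel _ _).symm


def TacNull {A : Type u} [CommRing A] (T : ℤ → Type u) [∀ n, AddCommGroup (T n)]
    [∀ n, Module A (T n)] (dT : ∀ n, T n →ₗ[A] T (n + 1))
    (P : ℤ → Type u) [∀ n, AddCommGroup (P n)] [∀ n, Module A (P n)]
    (dP : ∀ n, P n →ₗ[A] P (n + 1)) (t : ∀ n, T n →ₗ[A] P n)
    (B : ℤ → Type u) (δ : ∀ n, B n → (B (n + 1) →₀ A)) : Prop :=
  ∀ (fT : ∀ n, B n → T (n + 1)) (fP : ∀ n, B n → P n),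
    (∀ n b, Finsupp.linearCombination A (fT (n + 1)) (δ n b) = - dT (n + 1) (fT n b)) →
    (∀ n b, Finsupp.linearCombination A (fP (n + 1)) (δ n b) =
      t (n + 1) (fT n b) + dP n (fP n b)) →
    ∃ s : ∀ n, B n → T n,
      (∀ n b, fT n b = Finsupp.linearCombination A (s (n + 1)) (δ n b) - dT n (s n b)) ∧
      (∀ n b, fP n b = t n (s n b))

theorem tac_null_equiv {A : Type u} [CommRing A] (T : ℤ → Type u) [∀ n, AddCommGroup (T n)]
    [∀ n, Module A (T n)] (dT : ∀ n, T n →ₗ[A] T (n + 1))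
    (P : ℤ → Type u) [∀ n, AddCommGroup (P n)] [∀ n, Module A (P n)]
    (dP : ∀ n, P n →ₗ[A] P (n + 1)) (t : ∀ n, T n →ₗ[A] P n)
    (B C : ℤ → Type u) (δ : ∀ n, B n → (B (n + 1) →₀ A)) (e : ∀ n, B n ≃ C n)
    (h : TacNull T dT P dP t C (fun n c => (δ n ((e n).symm c)).mapDomain (e (n + 1)))) :
    TacNull T dT P dP t B δ := by
  intro fT fP h1 h2
  obtain ⟨s, hs1, hs2⟩ := h (fun n c => fT n ((e n).symm c)) (fun n c => fP n ((e n).symm c))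
    (fun n c => by
      rw [Finsupp.linearCombination_mapDomain, ← h1]
      congr 2
      funext b; simp)
    (fun n c => by
      rw [Finsupp.linearCombination_mapDomain, ← h2]
      congr 2
      funext b; simp)
  refine ⟨fun n b => s n (e n b), fun n b => ?_, fun n b => ?_⟩
  · have := hs1 n (e n b)
    rw [Finsupp.linearCombination_mapDomain, Equiv.symm_apply_apply] at this
    exact this
  · have := hs2 n (e n b)
    rw [Equiv.symm_apply_apply] at this
    exact this

theorem tac_good_equiv {A : Type u} [CommRing A] {ι : Type u} (J : ι → Type u)
    [∀ i, AddCommGroup (J i)] [∀ i, Module A (J i)]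
    (B C : ℤ → Type u) (δ : ∀ n, B n → (B (n + 1) →₀ A)) (e : ∀ n, B n ≃ C n)
    (h : TacGood J B δ) :
    TacGood J C (fun n c => (δ n ((e n).symm c)).mapDomain (e (n + 1))) := by
  have key : ∀ n (M : Type u) [AddCommGroup M] [Module A M] (z : B n →₀ M),
      tacD (fun c => (δ n ((e n).symm c)).mapDomain (e (n + 1))) M (z.mapDomain (e n)) =
        (tacD (δ n) M z).mapDomain (e (n + 1)) := by
    intro n M _ _ z
    rw [tacD_map, ← tacD_map_left]
    simp
  refine ⟨fun n c => ?_, fun i n z hz => ?_⟩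
  · rw [key, h.1, Finsupp.mapDomain_zero]
  · have hz1 : z = (z.mapDomain (e (n + 1)).symm).mapDomain (e (n + 1)) := by
      rw [← Finsupp.mapDomain_comp]; simp
    rw [hz1, key] at hz
    obtain ⟨y, hy⟩ := h.2 i n (z.mapDomain (e (n + 1)).symm) (by
      apply Finsupp.mapDomain_injective (e (n + 1 + 1)).injective
      rw [hz, Finsupp.mapDomain_zero])
    refine ⟨y.mapDomain (e n), ?_⟩
    rw [key, hy, ← hz1]

/-- restriction of a vector to a subset -/
noncomputable def tacRes {B M : Type u} [AddCommGroup M] (Z : Set B) (z : B →₀ M) : B →₀ M :=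
  Finsupp.mapDomain Subtype.val (z.subtypeDomain (· ∈ Z))

theorem tacRes_mem {B M : Type u} [AddCommGroup M] (Z : Set B) (z : B →₀ M) (b : B) (hb : b ∈ Z) :
    tacRes Z z b = z b :=
  Finsupp.mapDomain_apply Subtype.val_injective _ ⟨b, hb⟩

theorem tacRes_notMem {B M : Type u} [AddCommGroup M] (Z : Set B) (z : B →₀ M) (b : B)
    (hb : b ∉ Z) : tacRes Z z b = 0 := by
  refine Finsupp.mapDomain_of_notMem_range _ _ ?_
  rintro ⟨x, rfl⟩
  exact hb x.2

theorem tacD_sub_domain {A : Type u} [CommRing A] {B C : Type u} (δ : B → (C →₀ A)) (Z : Set C)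
    (M : Type u) [AddCommGroup M] [Module A M] (z : B →₀ M) :
    tacD (fun b => (δ b).subtypeDomain (· ∈ Z)) M z = (tacD δ M z).subtypeDomain (· ∈ Z) := by
  ext c
  rw [tacD_apply]
  exact (tacD_apply δ M z c.1).symm

theorem tac_sub_zero {B M : Type u} [AddCommGroup M] (Z : Set B) (z : B →₀ M)
    (h : ∀ b ∈ Z, z b = 0) : z.subtypeDomain (· ∈ Z) = 0 := by
  ext b; exact h b.1 b.2

theorem tacD_closed {A : Type u} [CommRing A] {B C : Type u} (δ : B → (C →₀ A)) (U : Set B)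
    (U' : Set C) (h : ∀ b ∈ U, ∀ c, c ∉ U' → δ b c = 0)
    (M : Type u) [AddCommGroup M] [Module A M] (z : B →₀ M) (hz : ∀ b, b ∉ U → z b = 0) :
    ∀ c, c ∉ U' → tacD δ M z c = 0 := by
  intro c hc
  apply tacD_supp
  intro b hb
  exact h b (by by_contra h'; exact hb (hz b h')) c hc

theorem tac_quot {A : Type u} [CommRing A] {ι : Type u} (J : ι → Type u)
    [∀ i, AddCommGroup (J i)] [∀ i, Module A (J i)] (B : ℤ → Type u)
    (δ : ∀ n, B n → (B (n + 1) →₀ A)) (h0 : ∀ n b, tacD (δ (n + 1)) A (δ n b) = 0)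
    (U Z : ∀ n, Set (B n)) (hdis : ∀ n b, b ∈ Z n → b ∉ U n)
    (hU : ∀ n, ∀ b ∈ U n, ∀ b', b' ∉ U (n + 1) → δ n b b' = 0)
    (hZ : ∀ n, ∀ b ∈ Z n, ∀ b', b' ∉ U (n + 1) → b' ∉ Z (n + 1) → δ n b b' = 0)
    (hgU : TacGoodOn J B δ U)
    (hrel : ∀ i n (z : B (n + 1) →₀ J i), (∀ b, b ∉ Z (n + 1) → z b = 0) →
      (∀ b, b ∉ U (n + 1 + 1) → tacD (δ (n + 1)) (J i) z b = 0) →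
      ∃ y : B n →₀ J i, (∀ b, b ∉ U n → b ∉ Z n → y b = 0) ∧
        ∀ b, b ∉ U (n + 1) → (z - tacD (δ n) (J i) y) b = 0) :
    TacGood J (fun n => Z n) (fun n b => (δ n b.1).subtypeDomain (· ∈ Z (n + 1))) ∧
    TacGoodOn J B δ (fun n => U n ∪ Z n) := by
  -- splitting off the part in `U`
  have split : ∀ n (M : Type u) [AddCommGroup M] (z : B n →₀ M),
      (∀ b, b ∉ U n → b ∉ Z n → z b = 0) → ∀ b, b ∉ U n → (z - tacRes (Z n) z) b = 0 := by
    intro n M _ z hz b hb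
    rw [Finsupp.sub_apply]
    by_cases hbZ : b ∈ Z n
    · rw [tacRes_mem _ _ _ hbZ, sub_self]
    · rw [tacRes_notMem _ _ _ hbZ, sub_zero, hz b hb hbZ]
  have hDU : ∀ n (M : Type u) [AddCommGroup M] [Module A M] (z : B n →₀ M),
      (∀ b, b ∉ U n → z b = 0) → ∀ b, b ∉ U (n + 1) → tacD (δ n) M z b = 0 :=
    fun n M _ _ z hz => tacD_closed (δ n) (U n) (U (n + 1)) (hU n) M z hz
  have hDZ : ∀ n (M : Type u) [AddCommGroup M] [Module A M] (z : Z n →₀ M),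
      tacD (fun b : Z n => (δ n b.1).subtypeDomain (· ∈ Z (n + 1))) M z =
        (tacD (δ n) M (Finsupp.mapDomain Subtype.val z)).subtypeDomain (· ∈ Z (n + 1)) := by
    intro n M _ _ z
    rw [tacD_sub_domain (fun b : Z n => δ n b.1), tacD_map]
  have hDsub : ∀ n (M : Type u) [AddCommGroup M] [Module A M] (z : B n →₀ M),
      (∀ b, b ∉ U n → b ∉ Z n → z b = 0) →
      tacD (fun b : Z n => (δ n b.1).subtypeDomain (· ∈ Z (n + 1))) M
        (z.subtypeDomain (· ∈ Z n)) = (tacD (δ n) M z).subtypeDomain (· ∈ Z (n + 1)) := by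
    intro n M _ _ z hz
    rw [hDZ]
    have h1 : tacD (δ n) M z = tacD (δ n) M (tacRes (Z n) z) +
      tacD (δ n) M (z - tacRes (Z n) z) := by
      rw [← map_add]; congr 1; abel
    rw [h1, Finsupp.subtypeDomain_add, tac_sub_zero (z := tacD (δ n) M (z - tacRes (Z n) z)),
      add_zero]
    · rfl
    · intro b hb
      exact hDU n M _ (split n M z hz) b (hdis _ _ hb)
  refine ⟨⟨fun n b => ?_, fun i n z hz => ?_⟩, fun i n z hz hz0 => ?_⟩
  · rw [hDsub _ _ _ (hZ n b.1 b.2), h0, Finsupp.subtypeDomain_zero]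
  · have hzZ : ∀ b, b ∉ Z (n + 1) → Finsupp.mapDomain Subtype.val z b = 0 := by
      intro b hb
      refine Finsupp.mapDomain_of_notMem_range _ _ ?_
      rintro ⟨x, rfl⟩
      exact hb x.2
    rw [hDZ] at hz
    obtain ⟨y, hy1, hy2⟩ := hrel i n (Finsupp.mapDomain Subtype.val z) hzZ (by
      intro b hb
      by_cases hbZ : b ∈ Z (n + 1 + 1)
      · exact DFunLike.congr_fun hz ⟨b, hbZ⟩
      · refine tacD_closed (δ (n + 1)) (Z (n + 1)) (U (n + 1 + 1) ∪ Z (n + 1 + 1)) ?_ _ _ hzZ b ?_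
        · intro c hc c' hc'
          exact hZ _ c hc c' (fun h => hc' (Or.inl h)) (fun h => hc' (Or.inr h))
        · rintro (h | h)
          · exact hb h
          · exact hbZ h)
    refine ⟨y.subtypeDomain (· ∈ Z n), ?_⟩
    rw [hDsub _ _ _ hy1]
    ext b
    have h1 := hy2 b.1 (hdis _ _ b.2)
    rw [Finsupp.sub_apply, Finsupp.mapDomain_apply Subtype.val_injective, sub_eq_zero] at h1
    exact h1.symm
  · have hz' : ∀ b, b ∉ U (n + 1) → b ∉ Z (n + 1) → z b = 0 := fun b h1 h2 =>
      hz b (fun h => h.elim h1 h2)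
    have hsp := split _ _ z hz'
    obtain ⟨y, hy1, hy2⟩ := hrel i n (tacRes (Z (n + 1)) z)
      (fun b hb => tacRes_notMem _ _ _ hb) (by
        have : tacD (δ (n + 1)) (J i) (tacRes (Z (n + 1)) z) =
          - tacD (δ (n + 1)) (J i) (z - tacRes (Z (n + 1)) z) := by
          rw [map_sub, hz0]; abel
        intro b hb
        rw [this, Finsupp.neg_apply, hDU _ _ _ hsp b hb, neg_zero])
    obtain ⟨y', hy1', hy2'⟩ := hgU i n (z - tacD (δ n) (J i) y) (by
        intro b hb
        have h1 := hsp b hb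
        have h2 := hy2 b hb
        rw [Finsupp.sub_apply] at h1 h2 ⊢
        have h3 : z b = tacRes (Z (n + 1)) z b := sub_eq_zero.mp h1
        rw [h3]
        exact h2) (by
        rw [map_sub, hz0, tacD_D _ _ (h0 n), sub_zero])
    refine ⟨y + y', ?_, ?_⟩
    · intro b hb
      have hb1 : b ∉ U n := fun h => hb (Or.inl h)
      have hb2 : b ∉ Z n := fun h => hb (Or.inr h)
      rw [Finsupp.add_apply, hy1 b hb1 hb2, hy1' b hb1, add_zero]
    · rw [map_add, hy2']
      abel


inductive TacTm {ι : Type u} (J : ι → Type u) : ℤ → Type u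
  | base (n : ℤ) : TacTm J n
  | sub (n : ℤ) (w : TacTm J n) (k : ℕ) : TacTm J (n + 1)
  | node (n : ℤ) (N : ℕ) (w : Fin N → TacTm J (n + 1)) (i : ι) (c : Fin N → J i) (k : ℕ) :
      TacTm J n

noncomputable def tacKth {B M : Type u} [AddCommGroup M] (v : B →₀ M) (k : ℕ) : Option B :=
  v.support.toList[k]?

theorem tacKth_exists {B M : Type u} [AddCommGroup M] (v : B →₀ M) (b : B) (h : v b ≠ 0) :
    ∃ k, tacKth v k = some b := by
  have : b ∈ v.support.toList := by simpa using h
  obtain ⟨k, hk, hb⟩ := List.getElem_of_mem this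
  exact ⟨k, by rw [tacKth, List.getElem?_eq_getElem hk, hb]⟩

noncomputable def tacEv {A : Type u} [CommRing A] {ι : Type u} {J : ι → Type u}
    [∀ i, AddCommGroup (J i)] {B : ℤ → Type u}
    (δ : ∀ n, B n → (B (n + 1) →₀ A)) (bb : ∀ n, Option (B n))
    (Y : ∀ i n, (B (n + 1) →₀ J i) → (B n →₀ J i)) : ∀ n, TacTm J n → Option (B n)
  | _, .base n => bb n
  | _, .sub n w k => (tacEv δ bb Y n w).elim none (fun b => tacKth (δ n b) k)
  | _, .node n _ w i c k => tacKth (Y i n (∑ j, (tacEv δ bb Y (n + 1) (w j)).elim 0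
      (fun b => Finsupp.single b (c j)))) k

/-- every proper good subcomplex can be enlarged by a small good quotient -/
theorem tac_enlarge {A : Type u} [CommRing A] {ι : Type u} (J : ι → Type u)
    [∀ i, AddCommGroup (J i)] [∀ i, Module A (J i)] (B : ℤ → Type u)
    (δ : ∀ n, B n → (B (n + 1) →₀ A)) (hg : TacGood J B δ)
    (U : ∀ n, Set (B n))
    (hU : ∀ n, ∀ b ∈ U n, ∀ b', b' ∉ U (n + 1) → δ n b b' = 0)
    (hgU : TacGoodOn J B δ U) (n0 : ℤ) (b0 : B n0) (hb0 : b0 ∉ U n0) :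
    ∃ Z : ∀ n, Set (B n), (∀ n b, b ∈ Z n → b ∉ U n) ∧
      (∃ n b, b ∈ Z n) ∧
      (∃ ε : ∀ n, Z n → TacTm J n, ∀ n, Function.Injective (ε n)) ∧
      (∀ n, ∀ b ∈ Z n, ∀ b', b' ∉ U (n + 1) → b' ∉ Z (n + 1) → δ n b b' = 0) ∧
      TacGood J (fun n => Z n) (fun n b => (δ n b.1).subtypeDomain (· ∈ Z (n + 1))) ∧
      TacGoodOn J B δ (fun n => U n ∪ Z n) := by
  classical
  have hY : ∀ i n (z : B (n + 1) →₀ J i), ∃ y : B n →₀ J i,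
      (∀ b, b ∉ U (n + 1 + 1) → tacD (δ (n + 1)) (J i) z b = 0) →
        ∀ b, b ∉ U (n + 1) → (z - tacD (δ n) (J i) y) b = 0 := by
    intro i n z
    by_cases h : ∀ b, b ∉ U (n + 1 + 1) → tacD (δ (n + 1)) (J i) z b = 0
    · obtain ⟨w, hw1, hw2⟩ := hgU i (n + 1) _ h (tacD_D _ _ (hg.1 (n + 1)) _ z)
      obtain ⟨y, hy⟩ := hg.2 i n (z - w) (by rw [map_sub, hw2, sub_self])
      refine ⟨y, fun _ b hb => ?_⟩
      rw [hy, sub_sub_cancel, hw1 b hb]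
    · exact ⟨0, fun h' => absurd h' h⟩
  choose Y hY using hY
  let bb : ∀ n, Option (B n) := fun n => if h : ∃ b, b ∉ U n then some h.choose else none
  let Z : ∀ n, Set (B n) := fun n => {b | b ∉ U n ∧ ∃ w, tacEv δ bb Y n w = some b}
  have hZ : ∀ n, ∀ b ∈ Z n, ∀ b', b' ∉ U (n + 1) → b' ∉ Z (n + 1) → δ n b b' = 0 := by
    rintro n b ⟨_, w, hw⟩ b' hb' hbZ
    by_contra hne
    obtain ⟨k, hk⟩ := tacKth_exists _ _ hne
    refine hbZ ⟨hb', .sub n w k, ?_⟩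
    rw [tacEv, hw]
    exact hk
  have hdis : ∀ n b, b ∈ Z n → b ∉ U n := fun n b h => h.1
  have hq := tac_quot J B δ hg.1 U Z hdis hU hZ hgU (by
    intro i n z hzZ hDz
    refine ⟨Y i n z, ?_, hY i n z hDz⟩
    intro b hbU hbZ
    by_contra hne
    obtain ⟨k, hk⟩ := tacKth_exists _ _ hne
    have hw : ∀ j : Fin z.support.card, ∃ w,
        tacEv δ bb Y (n + 1) w = some (z.support.equivFin.symm j).1 := by
      intro j
      have h1 : (z.support.equivFin.symm j).1 ∈ Z (n + 1) := by
        by_contra hcon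
        exact Finsupp.mem_support_iff.mp (z.support.equivFin.symm j).2 (hzZ _ hcon)
      exact h1.2
    choose w hw using hw
    refine hbZ ⟨hbU, .node n z.support.card w i (fun j => z (z.support.equivFin.symm j).1) k, ?_⟩
    rw [tacEv]
    simp_rw [hw]
    simp only [Option.elim]
    rw [Equiv.sum_comp z.support.equivFin.symm
        (fun x => Finsupp.single x.1 (z x.1)),
        Finset.sum_coe_sort z.support (fun x => Finsupp.single x (z x))]
    rw [show (∑ x ∈ z.support, Finsupp.single x (z x)) = z from Finsupp.sum_single _]
    exact hk)
  refine ⟨Z, hdis, ?_, ?_, hZ, hq.1, hq.2⟩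
  · have h : ∃ b, b ∉ U n0 := ⟨b0, hb0⟩
    refine ⟨n0, h.choose, h.choose_spec, .base n0, ?_⟩
    rw [tacEv]
    exact dif_pos h
  · refine ⟨fun n b => b.2.2.choose, fun n b b' h => ?_⟩
    have h1 := b.2.2.choose_spec
    have h2 := b'.2.2.choose_spec
    have h : b.2.2.choose = b'.2.2.choose := h
    rw [h, h2] at h1
    exact Subtype.ext (Option.some.inj h1.symm)


theorem tac_lc_congr {A : Type u} [CommRing A] {B M : Type u} [AddCommGroup M] [Module A M]
    (f g : B → M) (v : B →₀ A) (h : ∀ b, v b ≠ 0 → f b = g b) :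
    Finsupp.linearCombination A f v = Finsupp.linearCombination A g v := by
  rw [Finsupp.linearCombination_apply, Finsupp.linearCombination_apply]
  refine Finset.sum_congr rfl fun b hb => ?_
  change v b • f b = v b • g b
  rw [h b (Finsupp.mem_support_iff.mp hb)]

theorem tac_lc_lc {A : Type u} [CommRing A] {B C M : Type u} [AddCommGroup M] [Module A M]
    (s : C → M) (δ : B → (C →₀ A)) (v : B →₀ A) :
    Finsupp.linearCombination A (fun b => Finsupp.linearCombination A s (δ b)) v =
      Finsupp.linearCombination A s (tacD δ A v) := by
  rw [tacD_eq_lc]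
  induction v using Finsupp.induction_linear with
  | zero => simp
  | add v w hv hw => rw [map_add, map_add, map_add, hv, hw]
  | single b a => simp

theorem tac_lc_map {A : Type u} [CommRing A] {B M N : Type u} [AddCommGroup M] [Module A M]
    [AddCommGroup N] [Module A N] (g : M →ₗ[A] N)
    (s : B → M) (v : B →₀ A) :
    Finsupp.linearCombination A (fun b => g (s b)) v = g (Finsupp.linearCombination A s v) := by
  rw [Finsupp.linearCombination_apply, Finsupp.linearCombination_apply, Finsupp.sum, Finsupp.sum,
    map_sum]
  simp

theorem tac_lc_add {A : Type u} [CommRing A] {B M : Type u} [AddCommGroup M] [Module A M]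
    (f g : B → M) (v : B →₀ A) :
    Finsupp.linearCombination A (fun b => f b + g b) v =
      Finsupp.linearCombination A f v + Finsupp.linearCombination A g v := by
  simp only [Finsupp.linearCombination_apply, Finsupp.sum, smul_add, Finset.sum_add_distrib]

theorem tac_lc_sub {A : Type u} [CommRing A] {B M : Type u} [AddCommGroup M] [Module A M]
    (f g : B → M) (v : B →₀ A) :
    Finsupp.linearCombination A (fun b => f b - g b) v =
      Finsupp.linearCombination A f v - Finsupp.linearCombination A g v := by
  simp only [Finsupp.linearCombination_apply, Finsupp.sum, smul_sub, Finset.sum_sub_distrib]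

theorem tac_lc_sub_domain {A : Type u} [CommRing A] {B M : Type u} [AddCommGroup M] [Module A M]
    (f : B → M) (Z : Set B) (v : B →₀ A) (h : ∀ b, v b ≠ 0 → b ∉ Z → f b = 0) :
    Finsupp.linearCombination A (fun b : Z => f b.1) (v.subtypeDomain (· ∈ Z)) =
      Finsupp.linearCombination A f v := by
  classical
  have h1 : Finsupp.linearCombination A (fun b : Z => f b.1) (v.subtypeDomain (· ∈ Z)) =
      Finsupp.linearCombination A f (tacRes Z v) := by
    rw [tacRes, Finsupp.linearCombination_mapDomain]; rfl
  rw [h1]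
  have h2 : v = tacRes Z v + (v - tacRes Z v) := by abel
  conv_rhs => rw [h2, map_add]
  rw [left_eq_add, tac_lc_congr f (fun _ => 0)]
  · simp [Finsupp.linearCombination_apply]
  · intro b hb
    rw [Finsupp.sub_apply] at hb
    by_cases hbZ : b ∈ Z
    · rw [tacRes_mem _ _ _ hbZ, sub_self] at hb
      exact absurd rfl hb
    · rw [tacRes_notMem _ _ _ hbZ, sub_zero] at hb
      exact h b hb hbZ

theorem tac_extend {A : Type u} [CommRing A] (T : ℤ → Type u) [∀ n, AddCommGroup (T n)]
    [∀ n, Module A (T n)] (dT : ∀ n, T n →ₗ[A] T (n + 1))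
    (hT : ∀ n x, dT (n + 1) (dT n x) = 0)
    (P : ℤ → Type u) [∀ n, AddCommGroup (P n)] [∀ n, Module A (P n)]
    (dP : ∀ n, P n →ₗ[A] P (n + 1)) (t : ∀ n, T n →ₗ[A] P n)
    (ht : ∀ n x, t (n + 1) (dT n x) = dP n (t n x))
    (B : ℤ → Type u) (δ : ∀ n, B n → (B (n + 1) →₀ A))
    (h0 : ∀ n b, tacD (δ (n + 1)) A (δ n b) = 0)
    (U Z : ∀ n, Set (B n)) (hdis : ∀ n b, b ∈ Z n → b ∉ U n)
    (hU : ∀ n, ∀ b ∈ U n, ∀ b', b' ∉ U (n + 1) → δ n b b' = 0)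
    (hZ : ∀ n, ∀ b ∈ Z n, ∀ b', b' ∉ U (n + 1) → b' ∉ Z (n + 1) → δ n b b' = 0)
    (hnull : TacNull T dT P dP t (fun n => Z n)
      (fun n b => (δ n b.1).subtypeDomain (· ∈ Z (n + 1))))
    (fT : ∀ n, B n → T (n + 1)) (fP : ∀ n, B n → P n)
    (h1 : ∀ n b, Finsupp.linearCombination A (fT (n + 1)) (δ n b) = - dT (n + 1) (fT n b))
    (h2 : ∀ n b, Finsupp.linearCombination A (fP (n + 1)) (δ n b) =
      t (n + 1) (fT n b) + dP n (fP n b))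
    (s : ∀ n, B n → T n)
    (hs1 : ∀ n, ∀ b ∈ U n,
      fT n b = Finsupp.linearCombination A (s (n + 1)) (δ n b) - dT n (s n b))
    (hs2 : ∀ n, ∀ b ∈ U n, fP n b = t n (s n b)) :
    ∃ s' : ∀ n, B n → T n, (∀ n, ∀ b ∈ U n, s' n b = s n b) ∧
      (∀ n, ∀ b ∈ U n ∪ Z n,
        fT n b = Finsupp.linearCombination A (s' (n + 1)) (δ n b) - dT n (s' n b)) ∧
      (∀ n, ∀ b ∈ U n ∪ Z n, fP n b = t n (s' n b)) := by
  classical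
  let gT : ∀ n, B n → T (n + 1) := fun n b =>
    fT n b - (Finsupp.linearCombination A (s (n + 1)) (δ n b) - dT n (s n b))
  let gP : ∀ n, B n → P n := fun n b => fP n b - t n (s n b)
  have g1 : ∀ n b, Finsupp.linearCombination A (gT (n + 1)) (δ n b) = - dT (n + 1) (gT n b) := by
    intro n b
    simp only [gT]
    rw [tac_lc_sub, tac_lc_sub, h1, tac_lc_lc, h0, tac_lc_map]
    simp only [map_sub, map_zero, hT]
    abel
  have g2 : ∀ n b, Finsupp.linearCombination A (gP (n + 1)) (δ n b) =
      t (n + 1) (gT n b) + dP n (gP n b) := by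
    intro n b
    simp only [gT, gP]
    rw [tac_lc_sub, h2, tac_lc_map]
    simp only [map_sub, ht]
    abel
  have gU1 : ∀ n, ∀ b ∈ U n, gT n b = 0 := fun n b hb => sub_eq_zero.mpr (hs1 n b hb)
  have gU2 : ∀ n, ∀ b ∈ U n, gP n b = 0 := fun n b hb => sub_eq_zero.mpr (hs2 n b hb)
  have hmem : ∀ n, ∀ b ∈ Z n, ∀ b', δ n b b' ≠ 0 → b' ∉ Z (n + 1) → b' ∈ U (n + 1) := by
    intro n b hb b' h h'
    by_contra hcon
    exact h (hZ n b hb b' hcon h')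
  obtain ⟨σ, hσ1, hσ2⟩ := hnull (fun n b => gT n b.1) (fun n b => gP n b.1)
    (fun n b => by
      rw [tac_lc_sub_domain (gT (n + 1)), g1]
      intro b' h h'
      exact gU1 _ _ (hmem n b.1 b.2 b' h h'))
    (fun n b => by
      rw [tac_lc_sub_domain (gP (n + 1)), g2]
      intro b' h h'
      exact gU2 _ _ (hmem n b.1 b.2 b' h h'))
  let s1 : ∀ n, B n → T n := fun n b => if h : b ∈ Z n then σ n ⟨b, h⟩ else 0
  have s1Z : ∀ n (b : Z n), s1 n b.1 = σ n b := fun n b => dif_pos b.2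
  have s1U : ∀ n b, b ∉ Z n → s1 n b = 0 := fun n b h => dif_neg h
  have hUZ : ∀ n b, b ∈ U n → b ∉ Z n := fun n b h h' => hdis n b h' h
  have k : ∀ n, ∀ b ∈ U n ∪ Z n,
      gT n b = Finsupp.linearCombination A (s1 (n + 1)) (δ n b) - dT n (s1 n b) ∧
      gP n b = t n (s1 n b) := by
    rintro n b (hb | hb)
    · rw [gU1 n b hb, gU2 n b hb, s1U n b (hUZ n b hb), tac_lc_congr (s1 (n + 1)) (fun _ => 0)]
      · simp [Finsupp.linearCombination_apply]
      · intro b' hb'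
        apply s1U
        apply hUZ
        by_contra hcon
        exact hb' (hU n b hb b' hcon)
    · rw [hσ1 n ⟨b, hb⟩, hσ2 n ⟨b, hb⟩, ← s1Z n ⟨b, hb⟩]
      refine ⟨?_, rfl⟩
      rw [← tac_lc_sub_domain (s1 (n + 1)) (Z (n + 1)) (δ n b)]
      · simp_rw [s1Z]
      · intro b' _ h
        exact s1U _ _ h
  refine ⟨fun n b => s n b + s1 n b, fun n b hb => ?_, fun n b hb => ?_, fun n b hb => ?_⟩
  · change s n b + s1 n b = s n b
    rw [s1U n b (hUZ n b hb), add_zero]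
  · have := (k n b hb).1
    simp only [gT] at this
    rw [sub_eq_iff_eq_add] at this
    rw [this, tac_lc_add, map_add]
    abel
  · have := (k n b hb).2
    simp only [gP] at this
    rw [sub_eq_iff_eq_add] at this
    rw [this, map_add]
    abel

theorem tac_partIV {A : Type u} [CommRing A] {ι : Type u} (J : ι → Type u)
    [∀ i, AddCommGroup (J i)] [∀ i, Module A (J i)] (T : ℤ → Type u) [∀ n, AddCommGroup (T n)]
    [∀ n, Module A (T n)] (dT : ∀ n, T n →ₗ[A] T (n + 1))
    (hT : ∀ n x, dT (n + 1) (dT n x) = 0)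
    (P : ℤ → Type u) [∀ n, AddCommGroup (P n)] [∀ n, Module A (P n)]
    (dP : ∀ n, P n →ₗ[A] P (n + 1)) (t : ∀ n, T n →ₗ[A] P n)
    (ht : ∀ n x, t (n + 1) (dT n x) = dP n (t n x))
    (hsmall : ∀ (Z : ℤ → Type u) (δZ : ∀ n, Z n → (Z (n + 1) →₀ A)), TacGood J Z δZ →
      (∃ ε : ∀ n, Z n → TacTm J n, ∀ n, Function.Injective (ε n)) → TacNull T dT P dP t Z δZ)
    (B : ℤ → Type u) (δ : ∀ n, B n → (B (n + 1) →₀ A)) (hg : TacGood J B δ) :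
    TacNull T dT P dP t B δ := by
  classical
  intro fT fP h1 h2
  let Q := {a : (∀ n, Set (B n)) × (∀ n, B n → T n) //
    (∀ n, ∀ b ∈ a.1 n, ∀ b', b' ∉ a.1 (n + 1) → δ n b b' = 0) ∧
    TacGoodOn J B δ a.1 ∧
    (∀ n, ∀ b ∈ a.1 n,
      fT n b = Finsupp.linearCombination A (a.2 (n + 1)) (δ n b) - dT n (a.2 n b)) ∧
    (∀ n, ∀ b ∈ a.1 n, fP n b = t n (a.2 n b))}
  let r : Q → Q → Prop := fun a a' => (∀ n, a.1.1 n ⊆ a'.1.1 n) ∧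
    ∀ n, ∀ b ∈ a.1.1 n, a'.1.2 n b = a.1.2 n b
  obtain ⟨m, hm⟩ : ∃ m : Q, ∀ a, r m a → r a m := by
    refine exists_maximal_of_chains_bounded ?_ ?_
    · intro c hc
      have hcomp : ∀ a ∈ c, ∀ a' ∈ c, ∀ n b, b ∈ a.1.1 n → b ∈ a'.1.1 n →
          a.1.2 n b = a'.1.2 n b := by
        intro a ha a' ha' n b hb hb'
        by_cases e : a = a'
        · rw [e]
        · rcases hc ha ha' e with h | h
          · exact (h.2 n b hb).symm
          · exact h.2 n b hb'
      let U : ∀ n, Set (B n) := fun n => {b | ∃ a ∈ c, b ∈ a.1.1 n}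
      let s : ∀ n, B n → T n := fun n b => if h : ∃ a ∈ c, b ∈ a.1.1 n then h.choose.1.2 n b else 0
      have hs : ∀ a ∈ c, ∀ n b, b ∈ a.1.1 n → s n b = a.1.2 n b := by
        intro a ha n b hb
        have h : ∃ a ∈ c, b ∈ a.1.1 n := ⟨a, ha, hb⟩
        simp only [s]
        rw [dif_pos h]
        exact hcomp _ h.choose_spec.1 a ha n b h.choose_spec.2 hb
      have hfin : ∀ n (F : Finset (B n)), F.Nonempty → (∀ b ∈ F, b ∈ U n) →
          ∃ a ∈ c, ∀ b ∈ F, b ∈ a.1.1 n := by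
        intro n F hF
        induction hF using Finset.Nonempty.cons_induction with
        | singleton b =>
          intro h
          obtain ⟨a, ha, hb⟩ := h b (by simp)
          exact ⟨a, ha, by simpa using hb⟩
        | cons b F hb hF ih =>
          intro h
          obtain ⟨a, ha, hab⟩ := ih (fun x hx => h x (by simp [hx]))
          obtain ⟨a', ha', hab'⟩ := h b (by simp)
          by_cases e : a = a'
          · subst e
            exact ⟨a, ha, by simpa using ⟨hab', hab⟩⟩
          · rcases hc ha ha' e with hr | hr
            · refine ⟨a', ha', ?_⟩
              intro x hx
              rcases Finset.mem_cons.mp hx with rfl | hx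
              · exact hab'
              · exact hr.1 n (hab x hx)
            · refine ⟨a, ha, ?_⟩
              intro x hx
              rcases Finset.mem_cons.mp hx with rfl | hx
              · exact hr.1 n hab'
              · exact hab x hx
      refine ⟨⟨(U, s), ?_, ?_, ?_, ?_⟩, ?_⟩
      · rintro n b ⟨a, ha, hb⟩ b' hb'
        exact a.2.1 n b hb b' (fun h => hb' ⟨a, ha, h⟩)
      · intro i n z hz hz0
        by_cases hne : z = 0
        · exact ⟨0, fun _ _ => rfl, by rw [hne, map_zero]⟩
        obtain ⟨a, ha, hza⟩ := hfin (n + 1) z.support (Finsupp.support_nonempty_iff.mpr hne) (by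
          intro b hb
          by_contra hcon
          exact Finsupp.mem_support_iff.mp hb (hz b hcon))
        obtain ⟨y, hy1, hy2⟩ := a.2.2.1 i n z (fun b hb => by
          by_contra hcon
          exact hb (hza b (Finsupp.mem_support_iff.mpr hcon))) hz0
        exact ⟨y, fun b hb => hy1 b (fun h => hb ⟨a, ha, h⟩), hy2⟩
      · rintro n b ⟨a, ha, hb⟩
        change fT n b = Finsupp.linearCombination A (s (n + 1)) (δ n b) - dT n (s n b)
        rw [hs a ha n b hb, a.2.2.2.1 n b hb]
        congr 1
        apply tac_lc_congr
        intro b' hb'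
        refine (hs a ha _ _ ?_).symm
        by_contra hcon
        exact hb' (a.2.1 n b hb b' hcon)
      · rintro n b ⟨a, ha, hb⟩
        change fP n b = t n (s n b)
        rw [hs a ha n b hb, a.2.2.2.2 n b hb]
      · intro a ha
        exact ⟨fun n b hb => ⟨a, ha, hb⟩, fun n b hb => hs a ha n b hb⟩
    · rintro a b c ⟨h, h'⟩ ⟨k, k'⟩
      exact ⟨fun n => (h n).trans (k n), fun n x hx => (k' n x (h n hx)).trans (h' n x hx)⟩
  have hall : ∀ n b, b ∈ m.1.1 n := by
    by_contra hcon
    push Not at hcon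
    obtain ⟨n0, b0, hb0⟩ := hcon
    obtain ⟨Z, hdis, ⟨n1, b1, hb1⟩, hε, hZ, hZg, hUZ⟩ :=
      tac_enlarge J B δ hg m.1.1 m.2.1 m.2.2.1 n0 b0 hb0
    obtain ⟨s', hs0, hs1, hs2⟩ := tac_extend T dT hT P dP t ht B δ hg.1 m.1.1 Z hdis m.2.1 hZ
      (hsmall _ _ hZg hε) fT fP h1 h2 m.1.2 m.2.2.2.1 m.2.2.2.2
    have := hm ⟨(fun n => m.1.1 n ∪ Z n, s'), by
      intro n b hb b' hb'
      have hb1 : b' ∉ m.1.1 (n + 1) := fun h => hb' (Or.inl h)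
      have hb2 : b' ∉ Z (n + 1) := fun h => hb' (Or.inr h)
      rcases hb with hb | hb
      · exact m.2.1 n b hb b' hb1
      · exact hZ n b hb b' hb1 hb2, hUZ, hs1, hs2⟩
      ⟨fun n b hb => Or.inl hb, fun n b hb => hs0 n b hb⟩
    exact hdis _ _ hb1 (this.1 n1 (Or.inr hb1))
  exact ⟨m.1.2, fun n b => m.2.2.2.1 n b (hall n b), fun n b => m.2.2.2.2 n b (hall n b)⟩


theorem tac_lc_single {A : Type u} [CommRing A] {B C : Type u} (g : B → C) (v : B →₀ A) :
    Finsupp.linearCombination A (fun b => Finsupp.single (g b) (1 : A)) v = v.mapDomain g := by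
  simp [Finsupp.linearCombination_apply, Finsupp.mapDomain]

theorem tac_approx {A : Type u} [CommRing A] {ι : Type u} (J : ι → Type u)
    [∀ i, AddCommGroup (J i)] [∀ i, Module A (J i)]
    (P : ℤ → Type u) [∀ n, AddCommGroup (P n)] [∀ n, Module A (P n)]
    (dP : ∀ n, P n →ₗ[A] P (n + 1)) :
    ∃ (V : ℤ → Type u) (δV : ∀ n, V n → (V (n + 1) →₀ A)) (t : ∀ n, (V n →₀ A) →ₗ[A] P n),
      TacGood J V δV ∧
      (∀ n x, t (n + 1) (tacD (δV n) A x) = dP n (t n x)) ∧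
      ∀ (B : ℤ → Type u) (δ : ∀ n, B n → (B (n + 1) →₀ A)), TacGood J B δ →
        TacNull (fun n => V n →₀ A) (fun n => tacD (δV n) A) P dP t B δ := by
  let K := {x : Σ B : (∀ n, Set (TacTm J n)), ∀ n, B n → (B (n + 1) →₀ A) //
    TacGood J (fun n => x.1 n) x.2}
  obtain ⟨V, δV, t, hV, htV, hnull⟩ := tac_partIII J K (fun S n => S.1.1 n) (fun S n => S.1.2 n)
    (fun S => S.2) P dP
  have ht : ∀ n x, Finsupp.linearCombination A (t (n + 1)) (tacD (δV n) A x) =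
      dP n (Finsupp.linearCombination A (t n) x) := by
    intro n x
    rw [← tac_lc_lc, ← tac_lc_map]
    simp_rw [htV]
  refine ⟨V, δV, fun n => Finsupp.linearCombination A (t n), hV, ht, ?_⟩
  refine tac_partIV J (fun n => V n →₀ A) (fun n => tacD (δV n) A)
    (fun n x => tacD_D _ _ (hV.1 n) _ x) P dP _ ht ?_
  rintro Z δZ hZ ⟨ε, hε⟩
  let e : ∀ n, Z n ≃ Set.range (ε n) := fun n => Equiv.ofInjective (ε n) (hε n)
  refine tac_null_equiv _ _ _ _ _ Z (fun n => Set.range (ε n)) δZ e ?_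
  have hC := tac_good_equiv J Z (fun n => Set.range (ε n)) δZ e hZ
  let S : K := ⟨⟨fun n => Set.range (ε n),
    fun n c => (δZ n ((e n).symm c)).mapDomain (e (n + 1))⟩, hC⟩
  intro fT fP h1 h2
  obtain ⟨s, hs1, hs2⟩ := hnull S fT fP (fun n b => by
    rw [tacD_eq_lc]
    exact h1 n b) h2
  refine ⟨fun n b => Finsupp.single (s n b) 1, fun n b => ?_, fun n b => ?_⟩
  · rw [hs1 n b, tacD_single_one]
    congr 1
    exact (tac_lc_single (s (n + 1)) _).symm
  · rw [hs2 n b]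
    simp

theorem tac_swindle {A : Type u} [CommRing A] (S : Type u) [AddCommGroup S] [Module A S]
    [Module.Projective A S] :
    ∃ I : Type u, Nonempty ((S × (ℕ →₀ (S →₀ A))) ≃ₗ[A] (I →₀ A)) := by
  obtain ⟨i, hi⟩ := Module.projective_def'.mp (inferInstance : Module.Projective A S)
  let p : (S →₀ A) →ₗ[A] S := Finsupp.linearCombination A id
  have hpi : ∀ x, p (i x) = x := fun x => DFunLike.congr_fun hi x
  let N := LinearMap.ker p
  let e0 : (S →₀ A) ≃ₗ[A] S × N := LinearEquiv.ofLinearMap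
    (p.prod (LinearMap.codRestrict N (LinearMap.id - i ∘ₗ p) (fun x => by
      simp [N, hpi])))
    (i.coprod N.subtype)
    (by
      apply LinearMap.ext
      rintro ⟨s, x⟩
      have hx : p x.1 = 0 := x.2
      apply Prod.ext
      · simp [hpi, hx]
      · apply Subtype.ext
        simp [hpi, hx])
    (by
      apply LinearMap.ext
      intro x
      simp)
  let e1 : (ℕ →₀ S × N) ≃ₗ[A] (ℕ →₀ S) × (ℕ →₀ N) := LinearEquiv.ofLinearMap
    ((Finsupp.mapRange.linearMap (LinearMap.fst A S N)).prod
      (Finsupp.mapRange.linearMap (LinearMap.snd A S N)))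
    ((Finsupp.mapRange.linearMap (LinearMap.inl A S N)).coprod
      (Finsupp.mapRange.linearMap (LinearMap.inr A S N)))
    (by
      apply LinearMap.ext
      rintro ⟨s, x⟩
      apply Prod.ext
      · ext k; simp
      · ext k; simp)
    (by
      apply LinearMap.ext
      intro x
      ext k <;> simp)
  let e2 : (S × (ℕ →₀ S)) ≃ₗ[A] (ℕ →₀ S) :=
    (LinearEquiv.prodComm A _ _).trans
    (((LinearEquiv.refl A (ℕ →₀ S)).prodCongr
      (Finsupp.uniqueLinearEquiv A S PUnit.unit.{1}).symm).trans
      ((Finsupp.sumFinsuppLEquivProdFinsupp A).symm.trans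
        (Finsupp.domLCongr Equiv.natSumPUnitEquivNat)))
  let e3 : (ℕ →₀ (S →₀ A)) ≃ₗ[A] (ℕ →₀ S) × (ℕ →₀ N) :=
    (Finsupp.mapRange.linearEquiv e0).trans e1
  refine ⟨ℕ × S, ⟨?_⟩⟩
  exact ((LinearEquiv.refl A S).prodCongr e3).trans
    ((LinearEquiv.prodAssoc A S (ℕ →₀ S) (ℕ →₀ N)).symm.trans
      ((e2.prodCongr (LinearEquiv.refl A _)).trans
        (e3.symm.trans (Finsupp.curryLinearEquiv A).symm)))


theorem tac_proj_null {A : Type u} [CommRing A] [IsNoetherianRing A]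
    (hdim : ringKrullDim A < ⊤) (D : TacData A)
    (T : ℤ → Type u) [∀ n, AddCommGroup (T n)]
    [∀ n, Module A (T n)] (dT : ∀ n, T n →ₗ[A] T (n + 1))
    (P : ℤ → Type u) [∀ n, AddCommGroup (P n)] [∀ n, Module A (P n)]
    (dP : ∀ n, P n →ₗ[A] P (n + 1)) (t : ∀ n, T n →ₗ[A] P n)
    (hnull : ∀ (B : ℤ → Type u) (δ : ∀ n, B n → (B (n + 1) →₀ A)), TacGood D.J B δ →
      TacNull T dT P dP t B δ)
    (S : ℤ → Type u) [∀ n, AddCommGroup (S n)] [∀ n, Module A (S n)]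
    (dS : ∀ n, S n →ₗ[A] S (n + 1)) (hS : ∀ n, Module.Projective A (S n))
    (hS0 : ∀ n x, dS (n + 1) (dS n x) = 0)
    (hS1 : ∀ n x, dS (n + 1) x = 0 → ∃ y, dS n y = x)
    (hS2 : ∀ (Q : Type u) [AddCommGroup Q] [Module A Q], Module.Projective A Q →
      TacHomAcyc A S dS Q)
    (fT : ∀ n, S n →ₗ[A] T (n + 1)) (fP : ∀ n, S n →ₗ[A] P n)
    (h1 : ∀ n x, fT (n + 1) (dS n x) = - dT (n + 1) (fT n x))
    (h2 : ∀ n x, fP (n + 1) (dS n x) = t (n + 1) (fT n x) + dP n (fP n x)) :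
    ∃ s : ∀ n, S n →ₗ[A] T n,
      (∀ n x, fT n x = s (n + 1) (dS n x) - dT n (s n x)) ∧ (∀ n x, fP n x = t n (s n x)) := by
  have hfree := fun n => tac_swindle (A := A) (S n)
  choose I hI using hfree
  let G : ℤ → Type u := fun n => ℕ →₀ (S n →₀ A)
  let X : ℤ → Type u := fun n => (S n × G n) × G (n + 1)
  let B : ℤ → Type u := fun n => I n ⊕ (ℕ × S (n + 1))
  let e : ∀ n, X n ≃ₗ[A] (B n →₀ A) := fun n =>
    ((hI n).some.prodCongr (Finsupp.curryLinearEquiv A).symm).trans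
      (Finsupp.sumFinsuppLEquivProdFinsupp A).symm
  let dX : ∀ n, X n →ₗ[A] X (n + 1) := fun n =>
    LinearMap.prod (LinearMap.prod (dS n ∘ₗ LinearMap.fst A _ _ ∘ₗ LinearMap.fst A _ _)
      (LinearMap.snd A _ _)) 0
  have hdX : ∀ n (x : S n) (a : G n) (b : G (n + 1)), dX n ((x, a), b) = ((dS n x, b), 0) :=
    fun n x a b => rfl
  let δ : ∀ n, B n → (B (n + 1) →₀ A) := fun n b =>
    e (n + 1) (dX n ((e n).symm (Finsupp.single b 1)))
  have hδ : ∀ n v, tacD (δ n) A v = e (n + 1) (dX n ((e n).symm v)) := by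
    intro n v
    have : tacD (δ n) A = (e (n + 1)).toLinearMap ∘ₗ dX n ∘ₗ (e n).symm.toLinearMap := by
      ext b : 2
      simp only [LinearMap.comp_apply, Finsupp.lsingle_apply, tacD_single_one]
      rfl
    rw [this]
    rfl
  have hdd : ∀ n x, dX (n + 1) (dX n x) = 0 := by
    rintro n ⟨⟨x, a⟩, b⟩
    rw [hdX, hdX, hS0]
    rfl
  have hgood : TacGood D.J B δ := by
    refine tac_good_of_acyc hdim D B δ ?_ ?_ ?_
    · intro n b
      rw [hδ]
      simp only [δ]
      rw [LinearEquiv.symm_apply_apply, hdd, map_zero]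
    · intro n z hz
      rw [hδ, LinearEquiv.map_eq_zero_iff] at hz
      obtain ⟨⟨⟨x, a⟩, b⟩, hx⟩ : ∃ y, y = (e (n + 1)).symm z := ⟨_, rfl⟩
      rw [← hx, hdX] at hz
      have hz1 : dS (n + 1) x = 0 := congrArg (fun w => w.1.1) hz
      have hz2 : b = 0 := congrArg (fun w => w.1.2) hz
      obtain ⟨y, hy⟩ := hS1 n x hz1
      refine ⟨e n ((y, 0), a), ?_⟩
      rw [hδ, LinearEquiv.symm_apply_apply, hdX, hy]
      rw [hz2] at hx
      change e (n + 1) ((x, a), 0) = z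
      rw [hx, LinearEquiv.apply_symm_apply]
    · intro Q _ _ hQ n φ hφ
      have hφ' : ∀ x, φ (e (n + 1) (dX n x)) = 0 := by
        intro x
        have := hφ (e n x)
        rw [hδ, LinearEquiv.symm_apply_apply] at this
        exact this
      let ψX : X (n + 1) →ₗ[A] Q := φ ∘ₗ (e (n + 1)).toLinearMap
      let φ1 : S (n + 1) →ₗ[A] Q := ψX ∘ₗ LinearMap.inl A _ _ ∘ₗ LinearMap.inl A _ _
      let φ3 : G (n + 1 + 1) →ₗ[A] Q := ψX ∘ₗ LinearMap.inr A _ _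
      obtain ⟨ψ1, hψ1⟩ := hS2 Q hQ n φ1 (by
        intro x
        exact hφ' ((x, 0), 0))
      refine ⟨(ψ1.coprod φ3 ∘ₗ LinearMap.fst A _ _) ∘ₗ (e (n + 1 + 1)).symm.toLinearMap, ?_⟩
      intro v
      obtain ⟨⟨⟨x, a⟩, b⟩, hx⟩ : ∃ y, y = (e (n + 1)).symm v := ⟨_, rfl⟩
      have hv : v = e (n + 1) ((x, a), b) := by rw [hx, LinearEquiv.apply_symm_apply]
      have ha : ψX ((0, a), 0) = 0 := by
        have := hφ' ((0, 0), a)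
        rw [hdX, map_zero] at this
        exact this
      have hsum : ψX ((x, a), b) = ψX ((x, 0), 0) + ψX ((0, a), 0) + ψX ((0, 0), b) := by
        rw [← map_add, ← map_add]
        congr 1
        exact Prod.ext (Prod.ext (by change x = x + 0 + 0; simp) (by change a = 0 + a + 0; simp))
          (by change b = 0 + 0 + b; simp)
      change ((ψ1.coprod φ3 ∘ₗ LinearMap.fst A _ _) ∘ₗ (e (n + 1 + 1)).symm.toLinearMap)
        (tacD (δ (n + 1)) A v) = φ v
      rw [hδ, ← hx, hdX]
      simp only [LinearMap.comp_apply, LinearEquiv.coe_coe, LinearEquiv.symm_apply_apply]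
      change ψ1 (dS (n + 1) x) + φ3 b = φ v
      rw [hψ1, hv]
      change ψX ((x, 0), 0) + ψX ((0, 0), b) = ψX ((x, a), b)
      rw [hsum, ha, add_zero]
  have hlc : ∀ n (M : Type u) [AddCommGroup M] [Module A M] (g : S n →ₗ[A] M) (v : B n →₀ A),
      Finsupp.linearCombination A
        (fun b => g ((e n).symm (Finsupp.single b 1)).1.1) v = g ((e n).symm v).1.1 := by
    intro n M _ _ g v
    have : Finsupp.linearCombination A
        (fun b => g ((e n).symm (Finsupp.single b 1)).1.1) =
        g ∘ₗ LinearMap.fst A _ _ ∘ₗ LinearMap.fst A _ _ ∘ₗ (e n).symm.toLinearMap := by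
      ext b : 2
      simp
    rw [this]
    rfl
  have hfst : ∀ n x, (dX n x).1.1 = dS n x.1.1 := fun n x => rfl
  obtain ⟨σ, hσ1, hσ2⟩ := hnull B δ hgood
    (fun n b => fT n ((e n).symm (Finsupp.single b 1)).1.1)
    (fun n b => fP n ((e n).symm (Finsupp.single b 1)).1.1)
    (fun n b => by
      rw [hlc, ← h1]
      simp only [δ]
      rw [LinearEquiv.symm_apply_apply, hfst])
    (fun n b => by
      rw [hlc, ← h2]
      simp only [δ]
      rw [LinearEquiv.symm_apply_apply, hfst])
  refine ⟨fun n => Finsupp.linearCombination A (σ n) ∘ₗ (e n).toLinearMap ∘ₗ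
    LinearMap.inl A _ _ ∘ₗ LinearMap.inl A _ _, fun n x => ?_, fun n x => ?_⟩
  · change fT n x = Finsupp.linearCombination A (σ (n + 1)) (e (n + 1) ((dS n x, 0), 0)) -
      dT n (Finsupp.linearCombination A (σ n) (e n ((x, 0), 0)))
    have h3 := hlc n _ (fT n) (e n ((x, 0), 0))
    simp_rw [hσ1] at h3
    rw [tac_lc_sub, tac_lc_lc, tac_lc_map, hδ, LinearEquiv.symm_apply_apply, hdX] at h3
    exact h3.symm
  · change fP n x = t n (Finsupp.linearCombination A (σ n) (e n ((x, 0), 0)))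
    have h3 := hlc n _ (fP n) (e n ((x, 0), 0))
    simp_rw [hσ2] at h3
    rw [tac_lc_map, LinearEquiv.symm_apply_apply] at h3
    exact h3.symm

end

/-- Over a commutative noetherian ring of finite Krull dimension, every complex `P` of
projective modules admits a map `t : T → P` from a totally acyclic complex of projectives such
that composition with `t` induces a bijection on homotopy classes of chain maps `S → T` and
`S → P`, for every totally acyclic complex `S` of projectives. -/
theorem totallyAcyclic_right_approximation
    (A : Type u) [CommRing A] [IsNoetherianRing A] (hdim : ringKrullDim A < ⊤)
    (P : ℤ → Type u) [∀ n, AddCommGroup (P n)] [∀ n, Module A (P n)]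
    (dP : ∀ n, P n →ₗ[A] P (n + 1)) (hP : ∀ n (x : P n), dP (n + 1) (dP n x) = 0)
    (hproj : ∀ n, Module.Projective A (P n)) :
    ∃ (T : ℤ → Type u) (_ : ∀ n, AddCommGroup (T n)) (_ : ∀ n, Module A (T n))
      (dT : ∀ n, T n →ₗ[A] T (n + 1)) (t : ∀ n, T n →ₗ[A] P n),
      (∀ n, Module.Projective A (T n)) ∧ IsTotallyAcyclic A T dT ∧
      IsChainMap A T dT P dP t ∧
      ∀ (S : ℤ → Type u) (_ : ∀ n, AddCommGroup (S n)) (_ : ∀ n, Module A (S n))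
        (dS : ∀ n, S n →ₗ[A] S (n + 1)),
        (∀ n, Module.Projective A (S n)) → IsTotallyAcyclic A S dS →
        (∀ f : ∀ n, S n →ₗ[A] P n, IsChainMap A S dS P dP f →
          ∃ g : ∀ n, S n →ₗ[A] T n, IsChainMap A S dS T dT g ∧
            ChainHomotopic A S dS P dP (fun n => t n ∘ₗ g n) f) ∧
        (∀ g g' : ∀ n, S n →ₗ[A] T n, IsChainMap A S dS T dT g →
          IsChainMap A S dS T dT g' →
          ChainHomotopic A S dS P dP (fun n => t n ∘ₗ g n) (fun n => t n ∘ₗ g' n) →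
          ChainHomotopic A S dS T dT g g') := by
  obtain ⟨D⟩ := tac_data_nonempty A
  obtain ⟨V, δV, t, hV, ht, hnull⟩ := tac_approx D.J P dP
  have hdd : ∀ n (x : V n →₀ A), tacD (δV (n + 1)) A (tacD (δV n) A x) = 0 := fun n x =>
    tacD_D (δV n) (δV (n + 1)) (hV.1 n) A x
  refine ⟨fun n => V n →₀ A, inferInstance, inferInstance, fun n => tacD (δV n) A, t,
    fun n => inferInstance, ⟨?_, ?_⟩, ht, ?_⟩
  · intro n z
    constructor
    · intro hz
      exact hV.2 none n z hz
    · rintro ⟨y, rfl⟩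
      exact hdd n y
  · intro Q _ _ hQ n φ
    constructor
    · intro hφ
      obtain ⟨ψ, hψ⟩ := tac_good_homAcyc hdim D V δV hV Q n φ (fun x => LinearMap.congr_fun hφ x)
      exact ⟨ψ, LinearMap.ext hψ⟩
    · rintro ⟨ψ, rfl⟩
      refine LinearMap.ext fun x => ?_
      change ψ (tacD (δV (n + 1)) A (tacD (δV n) A x)) = 0
      rw [hdd, map_zero]
  intro S _ _ dS hS hSt
  have hS0 : ∀ n x, dS (n + 1) (dS n x) = 0 := fun n x => (hSt.1 n).apply_apply_eq_zero x
  have hS1 : ∀ n x, dS (n + 1) x = 0 → ∃ y, dS n y = x := fun n x hx => (hSt.1 n x).1 hx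
  have hS2 : ∀ (Q : Type u) [AddCommGroup Q] [Module A Q], Module.Projective A Q →
      TacHomAcyc A S dS Q := by
    intro Q _ _ hQ n φ hφ
    obtain ⟨ψ, hψ⟩ := (hSt.2 Q hQ n φ).1 (LinearMap.ext hφ)
    exact ⟨ψ, fun x => LinearMap.congr_fun hψ x⟩
  constructor
  · intro f hf
    obtain ⟨s, hs1, hs2⟩ := tac_proj_null hdim D (fun n => V n →₀ A) (fun n => tacD (δV n) A)
      P dP t hnull S dS hS hS0 hS1 hS2 (fun n => 0) f (by intro n x; simp)
      (by intro n x; simpa using hf n x)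
    refine ⟨s, fun n x => ?_, fun n => 0, fun n x => ?_⟩
    · exact sub_eq_zero.1 (hs1 n x).symm
    · simp [hs2]
  · rintro g g' hg hg' ⟨s, hs⟩
    obtain ⟨σ, hσ1, hσ2⟩ := tac_proj_null hdim D (fun n => V n →₀ A) (fun n => tacD (δV n) A)
      P dP t hnull (fun n => S (n + 1)) (fun n => - dS (n + 1)) (fun n => hS (n + 1))
      (fun n x => by
        rw [LinearMap.neg_apply, LinearMap.neg_apply, map_neg, neg_neg]
        exact hS0 (n + 1) x)
      (fun n x hx => by
        obtain ⟨y, hy⟩ := hS1 (n + 1) x (neg_eq_zero.1 hx)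
        refine ⟨-y, ?_⟩
        rw [LinearMap.neg_apply, map_neg, neg_neg, hy])
      (by
        intro Q _ _ hQ n φ hφ
        obtain ⟨ψ, hψ⟩ := hS2 Q hQ (n + 1) φ (fun x => by
          have := hφ x
          rw [LinearMap.neg_apply, map_neg, neg_eq_zero] at this
          exact this)
        refine ⟨-ψ, fun x => ?_⟩
        rw [LinearMap.neg_apply, LinearMap.neg_apply, map_neg, neg_neg]
        exact hψ x)
      (fun n => g (n + 1) - g' (n + 1)) (fun n => - s n)
      (by
        intro n x
        have e1 := hg (n + 1) x
        have e2 := hg' (n + 1) x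
        simp only [LinearMap.neg_apply, LinearMap.sub_apply, map_neg, map_sub, e1, e2])
      (by
        intro n x
        have e1 := hs n x
        simp only [LinearMap.comp_apply] at e1
        simp only [LinearMap.neg_apply, LinearMap.sub_apply, map_neg, map_sub, neg_neg, e1]
        abel)
    refine ⟨fun n => - σ n, fun n x => ?_⟩
    have e1 := hσ1 n x
    simp only [LinearMap.neg_apply, LinearMap.sub_apply, map_neg] at e1 ⊢
    rw [e1]
    abel
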